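/- Let L(λ)=A+λB be a regular n×n Hermitian matrix pencil (A=A^*, B=B^*) with pairwise distinct (finite or infinite) eigenvalues λ_1,…,λ_κ, where λ_i has partial multiplicities n_{i,1} ≥ … ≥ n_{i,g_i} > 0. Let r ≥ 1, let 0 ≤ s ≤ ⌊r/2⌋, set ℓ = r−2s, and let Φ_s be the Hermitian parameterization map defined in the context, whose parameter space ℝ^{2ℓ} × ℂ^{(r+s)n} is identified with ℝ^{2ℓ+2(r+s)n} via real and imaginary parts. Then there exists a generic set G_s ⊆ ℝ^{2ℓ+2(r+s)n} such that for every parameter tuple in G_s, writing E = Φ_s of that tuple: (a) L+E is a regular pencil; (b) for each i = 1,…,κ, the partial multiplicities of L+E at λ_i are exactly n_{i,r+1} ≥ … ≥ n_{i,g_i} (in particular, if r ≥ g_i then λ_i is not an eigenvalue of L+E); (c) every (finite or infinite) eigenvalue of L+E that is not an eigenvalue of L is simple. -/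

import Mathlib

open Matrix Polynomial BigOperators

/-- The determinant of the pencil `A + λ B`, as a polynomial in `λ`. -/
noncomputable def pencilPoly (n : ℕ) (A B : Matrix (Fin n) (Fin n) ℂ) : Polynomial ℂ :=
  (A.map Polynomial.C + (Polynomial.X : Polynomial ℂ) • B.map Polynomial.C).det

/-- A pencil is regular if its determinant is not the zero polynomial. -/
def PencilRegular (n : ℕ) (A B : Matrix (Fin n) (Fin n) ℂ) : Prop :=
  pencilPoly n A B ≠ 0

/-- The order of vanishing of a polynomial at a point (`⊤` for the zero polynomial). -/
noncomputable def orderVan (p : Polynomial ℂ) (z : ℂ) : ℕ∞ :=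
  if p = 0 then ⊤ else (p.rootMultiplicity z : ℕ∞)

/-- `m_k(z)`: the minimum over all `k × k` submatrices `S(λ)` of `A + λB` of the order
of vanishing of `det S(λ)` at `z`. -/
noncomputable def minorOrder (n k : ℕ) (A B : Matrix (Fin n) (Fin n) ℂ) (z : ℂ) : ℕ∞ :=
  ⨅ (f : Fin k ↪ Fin n) (g : Fin k ↪ Fin n),
    orderVan (((A.map Polynomial.C + (Polynomial.X : Polynomial ℂ) • B.map Polynomial.C).submatrix f g).det) z

/-- The multiset of partial multiplicities of the pencil `A + λB` at the finite point
`z`: the positive values among `m_k(z) − m_{k−1}(z)`, `k = 1, …, n`. -/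
noncomputable def pmFin (n : ℕ) (A B : Matrix (Fin n) (Fin n) ℂ) (z : ℂ) : Multiset ℕ :=
  ((Multiset.range n).map fun k =>
    (minorOrder n (k + 1) A B z - minorOrder n k A B z).toNat).filter (fun m => 0 < m)

/-- The multiset of partial multiplicities of the pencil `A + λB` at a finite point
(`some z`) or at infinity (`none`, via the reversal pencil `B + λA` at `0`). -/
noncomputable def pmAt (n : ℕ) (A B : Matrix (Fin n) (Fin n) ℂ) : Option ℂ → Multiset ℕ
  | some z => pmFin n A B z
  | none => pmFin n B A 0

/-- `μ` (finite or infinite) is an eigenvalue of the pencil `A + λB` iff the list of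
partial multiplicities at `μ` is nonempty. -/
def IsEigenvalue (n : ℕ) (A B : Matrix (Fin n) (Fin n) ℂ) (μ : Option ℂ) : Prop :=
  pmAt n A B μ ≠ 0

/-- The algebraic multiplicity of a finite (`some z`) or infinite (`none`) eigenvalue. -/
noncomputable def algMultAt (n : ℕ) (A B : Matrix (Fin n) (Fin n) ℂ) : Option ℂ → ℕ
  | some z => (pencilPoly n A B).rootMultiplicity z
  | none => (pencilPoly n B A).rootMultiplicity 0

/-- A subset of `ι → ℂ` (i.e. `ℂ^N`, `N = #ι`) is generic if its complement is
contained in the common zero set of finitely many polynomials that are not all zero. -/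
def IsGenericC (ι : Type) [Fintype ι] (G : Set (ι → ℂ)) : Prop :=
  ∃ S : Finset (MvPolynomial ι ℂ), (∃ p ∈ S, p ≠ 0) ∧
    Gᶜ ⊆ { x | ∀ p ∈ S, MvPolynomial.eval x p = 0 }

/-- A subset of `ι → ℝ` (i.e. `ℝ^N`, `N = #ι`) is generic if its complement is
contained in the common zero set of finitely many real polynomials that are not all zero. -/
def IsGenericR (ι : Type) [Fintype ι] (G : Set (ι → ℝ)) : Prop :=
  ∃ S : Finset (MvPolynomial ι ℝ), (∃ p ∈ S, p ≠ 0) ∧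
    Gᶜ ⊆ { x | ∀ p ∈ S, MvPolynomial.eval x p = 0 }

/-- Index type for the complex parameters of the Hermitian parameterization `Φ_s`:
the coordinates of the vectors `u_1,…,u_ℓ, v_1,…,v_s, γ_1,…,γ_s, δ_1,…,δ_s ∈ ℂ^n`
(in total `(ℓ + 3s)n = (r + s)n` complex coordinates). -/
abbrev IdxC (l s n : ℕ) : Type := (Fin l ⊕ (Fin s ⊕ Fin s ⊕ Fin s)) × Fin n

/-- Real parameter space `ℝ^{2ℓ} × ℂ^{(r+s)n}` identified with `ℝ^{2ℓ+2(r+s)n}`: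
the reals `a_1, b_1, …, a_ℓ, b_ℓ` together with real and imaginary parts of the
complex coordinates. -/
abbrev IdxR (l s n : ℕ) : Type := (Fin l ⊕ Fin l) ⊕ (IdxC l s n ⊕ IdxC l s n)

/-- The complex vector entry encoded by real and imaginary parts. -/
noncomputable def cEnt {l s n : ℕ} (y : IdxR l s n → ℝ) (t : IdxC l s n) : ℂ :=
  (y (.inr (.inl t)) : ℂ) + (y (.inr (.inr t)) : ℂ) * Complex.I

/-- Constant coefficient of the Hermitian pencil
`Φ_s(y)(λ) = Σ_i (a_i + λ b_i) u_i u_i^* + Σ_j (v_j (γ_j + λ δ_j)^* + (γ_j + λ δ_j) v_j^*)`. -/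
noncomputable def PhiHermA (n l s : ℕ) (y : IdxR l s n → ℝ) : Matrix (Fin n) (Fin n) ℂ :=
  (∑ i : Fin l,
    ((y (.inl (.inl i)) : ℝ) : ℂ) •
      Matrix.vecMulVec (fun k => cEnt y (.inl i, k)) (star fun k => cEnt y (.inl i, k)))
  + ∑ j : Fin s,
      (Matrix.vecMulVec (fun k => cEnt y (.inr (.inl j), k))
          (star fun k => cEnt y (.inr (.inr (.inl j)), k))
        + Matrix.vecMulVec (fun k => cEnt y (.inr (.inr (.inl j)), k))
            (star fun k => cEnt y (.inr (.inl j), k)))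

/-- Coefficient of `λ` in the Hermitian pencil `Φ_s(y)(λ)`. -/
noncomputable def PhiHermB (n l s : ℕ) (y : IdxR l s n → ℝ) : Matrix (Fin n) (Fin n) ℂ :=
  (∑ i : Fin l,
    ((y (.inl (.inr i)) : ℝ) : ℂ) •
      Matrix.vecMulVec (fun k => cEnt y (.inl i, k)) (star fun k => cEnt y (.inl i, k)))
  + ∑ j : Fin s,
      (Matrix.vecMulVec (fun k => cEnt y (.inr (.inl j), k))
          (star fun k => cEnt y (.inr (.inr (.inr j)), k))
        + Matrix.vecMulVec (fun k => cEnt y (.inr (.inr (.inr j)), k))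
            (star fun k => cEnt y (.inr (.inl j), k)))

/-- The element `p` divides every `k × k` minor of the matrix `M`. -/
def MinorsDvd {R ι : Type*} [CommRing R] (M : Matrix ι ι R) (k : ℕ) (p : R) : Prop :=
  ∀ f g : Fin k → ι, p ∣ (M.submatrix f g).det

section Minors

variable {R ι : Type*} [CommRing R] {M : Matrix ι ι R} {k : ℕ} {p : R}

theorem MinorsDvd.succ (h : MinorsDvd M k p) : MinorsDvd M (k + 1) p := by
  intro f g
  rw [det_succ_row_zero]
  refine Finset.dvd_sum fun j _ => Dvd.dvd.mul_left ?_ _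
  rw [submatrix_submatrix]
  exact h _ _

theorem MinorsDvd.mono {l : ℕ} (hkl : k ≤ l) (h : MinorsDvd M k p) : MinorsDvd M l p := by
  induction l, hkl using Nat.le_induction with
  | base => exact h
  | succ l _ ih => exact ih.succ

theorem MinorsDvd.transpose (h : MinorsDvd M k p) : MinorsDvd Mᵀ k p := by
  intro f g
  rw [← det_transpose, transpose_submatrix, transpose_transpose]
  exact h g f

theorem MinorsDvd.mul_left [Fintype ι] (U : Matrix ι ι R) (h : MinorsDvd M k p) :
    MinorsDvd (U * M) k p := by
  classical
  intro f g
  have key : ((U * M).submatrix f g).det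
      = detRowAlternating fun i => ∑ j : ι, U (f i) j • fun l => M j (g l) := by
    change _ = det _
    congr 1
    ext i l
    simp [mul_apply, Finset.sum_apply]
  rw [key]
  change p ∣ (detRowAlternating (R := R)).toMultilinearMap _
  rw [MultilinearMap.map_sum]
  refine Finset.dvd_sum fun φ _ => ?_
  rw [MultilinearMap.map_smul_univ, smul_eq_mul]
  exact Dvd.dvd.mul_left (h φ g) _

theorem MinorsDvd.mul_right [Fintype ι] (V : Matrix ι ι R) (h : MinorsDvd M k p) :
    MinorsDvd (M * V) k p := by
  have := (h.transpose.mul_left Vᵀ).transpose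
  rwa [transpose_mul, transpose_transpose, transpose_transpose] at this

/-- The matrix determinant lemma over a commutative ring. -/
theorem det_add_vecMulVec [Fintype ι] [DecidableEq ι] (N : Matrix ι ι R) (x y : ι → R) :
    (N + vecMulVec x y).det = N.det + ∑ i, x i * (N.updateRow i y).det := by
  have key : ∀ S : Finset ι,
      (N + vecMulVec (fun i => if i ∈ S then x i else 0) y).det
        = N.det + ∑ i ∈ S, x i * (N.updateRow i y).det := by
    intro S
    induction S using Finset.induction_on with
    | empty =>
      simp only [Finset.notMem_empty, if_false, Finset.sum_empty, add_zero]
      congr 1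
      ext i j
      simp [vecMulVec_apply]
    | insert a S ha ih =>
      rw [Finset.sum_insert ha]
      set N' := N + vecMulVec (fun i => if i ∈ S then x i else 0) y with hN'
      have h1 : N + vecMulVec (fun i => if i ∈ insert a S then x i else 0) y
          = N'.updateRow a (N' a + x a • y) := by
        ext i j
        by_cases hi : i = a
        · subst hi
          simp [hN', vecMulVec_apply, ha]
        · simp [hN', vecMulVec_apply, hi]
      have h2 : (N'.updateRow a y).det = (N.updateRow a y).det := by
        refine det_eq_of_forall_row_eq_smul_add_const (fun i => if i ∈ S then x i else 0) a
          (by simp [ha]) fun i j => ?_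
        by_cases hi : i = a
        · subst hi
          simp [ha]
        · simp [hN', vecMulVec_apply, hi]
      rw [h1, det_updateRow_add, det_updateRow_smul, updateRow_eq_self, ih, h2]
      ring
  simpa using key Finset.univ

theorem MinorsDvd.add_vecMulVec (h : MinorsDvd M k p) (x y : ι → R) :
    MinorsDvd (M + vecMulVec x y) (k + 1) p := by
  intro f g
  have : (M + vecMulVec x y).submatrix f g = M.submatrix f g + vecMulVec (x ∘ f) (y ∘ g) := rfl
  rw [this, det_add_vecMulVec]
  refine dvd_add (h.succ f g) (Finset.dvd_sum fun i _ => Dvd.dvd.mul_left ?_ _)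
  rw [det_succ_row _ i]
  refine Finset.dvd_sum fun j _ => Dvd.dvd.mul_left ?_ _
  have : ((M.submatrix f g).updateRow i (y ∘ g)).submatrix i.succAbove j.succAbove
      = M.submatrix (f ∘ i.succAbove) (g ∘ j.succAbove) := by
    ext a b
    simp [updateRow_apply, Fin.succAbove_ne]
  rw [this]
  exact h _ _

theorem MinorsDvd.add_sum {J : Type*} (h : MinorsDvd M k p) (s : Finset J) (x y : J → ι → R) :
    MinorsDvd (M + ∑ j ∈ s, vecMulVec (x j) (y j)) (k + s.card) p := by
  classical
  induction s using Finset.induction_on with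
  | empty => simpa using h
  | insert a s ha ih =>
    rw [Finset.sum_insert ha, Finset.card_insert_of_notMem ha, add_comm (vecMulVec _ _), ← add_assoc,
      ← add_assoc]
    exact ih.add_vecMulVec _ _

/-- If a prime divides all submaximal minors, then its square divides the determinant. -/
theorem sq_dvd_det_of_minorsDvd [IsDomain R] {n : ℕ} {M : Matrix (Fin (n + 1)) (Fin (n + 1)) R}
    (hp : Prime p) (h : MinorsDvd M n p) : p ^ 2 ∣ M.det := by
  have hadj : ∀ i j, p ∣ M.adjugate i j := by
    intro i j
    rw [adjugate_fin_succ_eq_det_submatrix]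
    exact Dvd.dvd.mul_left (h _ _) _
  choose N hN using hadj
  obtain ⟨c, hc⟩ : p ∣ M.det := by
    have := h.succ id id
    simpa using this
  have h1 : M.adjugate = p • Matrix.of N := by
    ext i j
    simp [hN]
  have h2 : M * Matrix.of N = c • 1 := by
    have := mul_adjugate M
    rw [h1, hc, Matrix.mul_smul, mul_smul] at this
    ext i j
    have := congrFun (congrFun this i) j
    simp only [Matrix.smul_apply, smul_eq_mul] at this ⊢
    exact mul_left_cancel₀ hp.ne_zero this
  have h3 : p ∣ c ^ (n + 1) := by
    have := congrArg det h2
    rw [det_mul, hc, det_smul, det_one, Fintype.card_fin, mul_one, mul_assoc] at this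
    exact ⟨_, this.symm⟩
  rw [hc, sq]
  exact mul_dvd_mul_left p (hp.dvd_of_dvd_pow h3)

/-- Over a principal ideal domain a nonsingular matrix is equivalent to a diagonal one. -/
theorem exists_diagonal_equivalent [IsDomain R] [IsPrincipalIdealRing R] [Fintype ι]
    [DecidableEq ι] (M : Matrix ι ι R) (hM : M.det ≠ 0) :
    ∃ (U U' V V' : Matrix ι ι R) (a : ι → R), M = U * diagonal a * V ∧
      diagonal a = U' * M * V' := by
  have hinj : Function.Injective (Matrix.toLin' M) := by
    rw [← LinearMap.ker_eq_bot, Matrix.ker_toLin'_eq_bot_iff]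
    intro v hv
    exact eq_zero_of_mulVec_eq_zero hM hv
  let e := LinearEquiv.ofInjective (Matrix.toLin' M) hinj
  let N := LinearMap.range (Matrix.toLin' M)
  have hrank : Module.finrank R N = Module.finrank R (ι → R) := e.finrank_eq.symm
  obtain ⟨b', a, ab', hab⟩ := N.exists_smith_normal_form_of_rank_eq (Pi.basisFun R ι) hrank
  let c : Module.Basis ι R N := (Pi.basisFun R ι).map e
  have hc : ∀ i, (c i : ι → R) = fun l => M l i := by
    intro i
    have : (c i : ι → R) = Matrix.toLin' M (Pi.single i 1) := by
      simp only [c, e, Module.Basis.map_apply, Pi.basisFun_apply]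
      exact LinearEquiv.ofInjective_apply (Matrix.toLin' M) (h := hinj) (Pi.single i 1)
    rw [this, Matrix.toLin'_apply, mulVec_single_one]
    rfl
  let b := Pi.basisFun R ι
  let U := b.toMatrix b'
  let U' := b'.toMatrix b
  have hUU' : U' * U = 1 := b'.toMatrix_mul_toMatrix_flip b
  have hUd : U * diagonal a = M * c.toMatrix ab' := by
    ext l i
    have h1 : (ab' i : ι → R) = ∑ j, c.toMatrix ab' j i • (c j : ι → R) := by
      have := congrArg N.subtype (c.sum_toMatrix_smul_self ab' i)
      rw [map_sum] at this
      exact this.symm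
    have h2 := congrFun (hab i) l
    rw [h1] at h2
    simp only [Finset.sum_apply, Pi.smul_apply, smul_eq_mul, hc] at h2
    rw [mul_diagonal, mul_apply]
    simp only [U, b, Module.Basis.toMatrix_apply, Pi.basisFun_repr]
    rw [mul_comm, ← h2]
    exact Finset.sum_congr rfl fun j _ => by rw [mul_comm]; rfl
  have hVV' : c.toMatrix ab' * ab'.toMatrix c = 1 := c.toMatrix_mul_toMatrix_flip ab'
  refine ⟨U, U', ab'.toMatrix c, c.toMatrix ab', a, ?_, ?_⟩
  · rw [hUd, mul_assoc, hVV', mul_one]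
  · rw [mul_assoc, ← hUd, ← mul_assoc, hUU', one_mul]

end Minors

/-- The matrix polynomial `A + λ B`. -/
noncomputable def pencil {R : Type*} [CommRing R] {n : ℕ} (A B : Matrix (Fin n) (Fin n) R) :
    Matrix (Fin n) (Fin n) R[X] :=
  A.map Polynomial.C + (Polynomial.X : R[X]) • B.map Polynomial.C

section MinorOrder

variable {n k : ℕ} {A B : Matrix (Fin n) (Fin n) ℂ} {z : ℂ}

theorem pencilPoly_eq_det_pencil : pencilPoly n A B = (pencil A B).det := rfl

theorem le_orderVan_iff {p : ℂ[X]} {m : ℕ} :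
    (m : ℕ∞) ≤ orderVan p z ↔ (X - C z) ^ m ∣ p := by
  unfold orderVan
  split_ifs with h
  · simp [h]
  · rw [Nat.cast_le, Polynomial.le_rootMultiplicity_iff h]

theorem le_minorOrder_iff {m : ℕ} :
    (m : ℕ∞) ≤ minorOrder n k A B z ↔ MinorsDvd (pencil A B) k ((X - C z) ^ m) := by
  simp only [minorOrder, le_iInf_iff, le_orderVan_iff]
  refine ⟨fun h f g => ?_, fun h f g => h f g⟩
  by_cases hf : Function.Injective f
  · by_cases hg : Function.Injective g
    · exact h ⟨f, hf⟩ ⟨g, hg⟩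
    · obtain ⟨i, j, hij, hne⟩ := Function.not_injective_iff.mp hg
      rw [det_zero_of_column_eq hne (fun l => by simp [hij])]
      exact dvd_zero _
  · obtain ⟨i, j, hij, hne⟩ := Function.not_injective_iff.mp hf
    rw [det_zero_of_row_eq hne (by ext l; simp [hij])]
    exact dvd_zero _

theorem minorOrder_le_iff {m : ℕ} :
    minorOrder n k A B z ≤ m ↔ ¬ MinorsDvd (pencil A B) k ((X - C z) ^ (m + 1)) := by
  rw [← le_minorOrder_iff, not_le, Nat.cast_add, Nat.cast_one]
  exact (ENat.lt_add_one_iff (ENat.natCast_ne_top m)).symm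

theorem minorOrder_le_of_dvd {k' : ℕ} {A' B' : Matrix (Fin n) (Fin n) ℂ} {z' : ℂ}
    (h : ∀ m : ℕ, MinorsDvd (pencil A B) k ((X - C z) ^ m) →
      MinorsDvd (pencil A' B') k' ((X - C z') ^ m)) :
    minorOrder n k A B z ≤ minorOrder n k' A' B' z' := by
  refine ENat.forall_natCast_le_iff_le.mp fun m hm => ?_
  exact le_minorOrder_iff.mpr (h m (le_minorOrder_iff.mp hm))

theorem minorOrder_mono {l : ℕ} (hkl : k ≤ l) :
    minorOrder n k A B z ≤ minorOrder n l A B z :=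
  minorOrder_le_of_dvd fun _ h => h.mono hkl

theorem minorOrder_zero : minorOrder n 0 A B z = 0 := by
  refine le_antisymm ?_ zero_le
  refine minorOrder_le_iff.mpr fun h => ?_
  have h1 := h Fin.elim0 Fin.elim0
  rw [det_fin_zero, zero_add, pow_one] at h1
  exact not_isUnit_X_sub_C z (isUnit_of_dvd_one h1)

theorem minorsDvd_card_iff {R : Type*} [CommRing R] {M : Matrix (Fin n) (Fin n) R} {p : R} :
    MinorsDvd M n p ↔ p ∣ M.det := by
  refine ⟨fun h => by simpa using h id id, fun h f g => ?_⟩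
  have : M.submatrix f g
      = (1 : Matrix (Fin n) (Fin n) R).submatrix f id * M
          * (1 : Matrix (Fin n) (Fin n) R).submatrix id g := by
    ext i j
    simp [mul_apply, one_apply]
  rw [this, det_mul, det_mul]
  exact (h.mul_left _).mul_right _

theorem minorOrder_card : minorOrder n n A B z = orderVan (pencilPoly n A B) z := by
  refine ENat.eq_of_forall_natCast_le_iff fun m => ?_
  rw [le_minorOrder_iff, le_orderVan_iff, minorsDvd_card_iff, pencilPoly_eq_det_pencil]

theorem minorOrder_card_of_regular (h : PencilRegular n A B) :
    minorOrder n n A B z = ((pencilPoly n A B).rootMultiplicity z : ℕ) := by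
  rw [minorOrder_card, orderVan, if_neg h]

theorem minorOrder_ne_top (h : PencilRegular n A B) (hk : k ≤ n) :
    minorOrder n k A B z ≠ ⊤ := by
  refine ne_top_of_le_ne_top ?_ (minorOrder_mono hk)
  rw [minorOrder_card_of_regular h]
  exact ENat.natCast_ne_top _

/-- The exponents of a diagonal form at `z` determine the orders of the minors. -/
theorem exists_exponents (h : PencilRegular n A B) (z : ℂ) :
    ∃ e : Fin n → ℕ, ∀ k m : ℕ, (m : ℕ∞) ≤ minorOrder n k A B z ↔
      ∀ T : Finset (Fin n), T.card = k → m ≤ ∑ i ∈ T, e i := by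
  obtain ⟨U, U', V, V', a, h1, h2⟩ := exists_diagonal_equivalent (pencil A B) h
  have ha : ∀ i, a i ≠ 0 := by
    intro i hi
    apply h
    rw [pencilPoly_eq_det_pencil, h1, det_mul, det_mul, det_diagonal,
      Finset.prod_eq_zero (Finset.mem_univ i) hi]
    simp
  have hdvd : ∀ (T : Finset (Fin n)) (m : ℕ), (X - C z) ^ m ∣ ∏ i ∈ T, a i ↔
      m ≤ ∑ i ∈ T, (a i).rootMultiplicity z := by
    intro T m
    rw [← le_rootMultiplicity_iff (Finset.prod_ne_zero_iff.mpr fun i _ => ha i)]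
    rw [← Polynomial.count_roots, roots_prod _ _ (Finset.prod_ne_zero_iff.mpr fun i _ => ha i),
      Multiset.count_bind]
    simp only [count_roots, Finset.sum_map_val]
  refine ⟨fun i => (a i).rootMultiplicity z, fun k m => ?_⟩
  rw [le_minorOrder_iff]
  refine ⟨fun hm T hT => ?_, fun hm => ?_⟩
  · have h3 : MinorsDvd (diagonal a) k ((X - C z) ^ m) := by
      rw [h2]
      exact (hm.mul_left U').mul_right V'
    have h4 := h3 (T.orderEmbOfFin hT) (T.orderEmbOfFin hT)
    rw [submatrix_diagonal _ _ (T.orderEmbOfFin hT).injective, det_diagonal] at h4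
    rw [← hdvd]
    convert h4 using 1
    conv_lhs => rw [← Finset.image_orderEmbOfFin_univ T hT]
    rw [Finset.prod_image (fun _ _ _ _ hij => (T.orderEmbOfFin hT).injective hij)]
    rfl
  · rw [h1]
    refine MinorsDvd.mul_right V (MinorsDvd.mul_left U fun f g => ?_)
    have h3 : (diagonal a).submatrix f g
        = (1 : Matrix (Fin n) (Fin n) ℂ[X]).submatrix f g * diagonal (a ∘ g) := by
      ext i j
      simp only [submatrix_apply, mul_diagonal, diagonal_apply, one_apply, Function.comp]
      split_ifs with hij <;> simp [hij]
    by_cases hg : Function.Injective g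
    · rw [h3, det_mul, det_diagonal]
      refine Dvd.dvd.mul_left ?_ _
      have h5 := (hdvd (Finset.univ.image g) m).mpr
        (hm _ (by rw [Finset.card_image_of_injective _ hg, Finset.card_univ, Fintype.card_fin]))
      rwa [Finset.prod_image (fun _ _ _ _ hij => hg hij)] at h5
    · obtain ⟨i, j, hij, hne⟩ := Function.not_injective_iff.mp hg
      rw [det_zero_of_column_eq hne (fun l => by simp [hij])]
      exact dvd_zero _

/-- The increments of the orders of the minors are nondecreasing. -/
theorem minorOrder_convex (h : PencilRegular n A B) (z : ℂ) (hk : k + 2 ≤ n) :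
    2 * (minorOrder n (k + 1) A B z).toNat ≤
      (minorOrder n k A B z).toNat + (minorOrder n (k + 2) A B z).toNat := by
  obtain ⟨e, he⟩ := exists_exponents h z
  have hex : ∀ j ≤ n, ∃ T : Finset (Fin n), T.card = j ∧
      ∑ i ∈ T, e i ≤ (minorOrder n j A B z).toNat := by
    intro j hj
    by_contra! hcon
    have h1 := (he j ((minorOrder n j A B z).toNat + 1)).mpr fun T hT => hcon T hT
    rw [Nat.cast_add, Nat.cast_one, ENat.natCast_toNat (minorOrder_ne_top h hj)] at h1
    exact absurd h1 (not_le.mpr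
      ((ENat.lt_add_one_iff (minorOrder_ne_top h hj)).mpr le_rfl))
  have hle : ∀ j ≤ n, ∀ T : Finset (Fin n), T.card = j →
      (minorOrder n j A B z).toNat ≤ ∑ i ∈ T, e i := fun j hj T hT =>
    (he j _).mp (by rw [ENat.natCast_toNat (minorOrder_ne_top h hj)]) T hT
  obtain ⟨S, hS, hS'⟩ := hex k (by omega)
  obtain ⟨T, hT, hT'⟩ := hex (k + 2) hk
  obtain ⟨i, hiT, hiS⟩ := Finset.exists_mem_notMem_of_card_lt_card (s := S) (t := T) (by omega)
  have h1 := hle (k + 1) (by omega) (insert i S) (by rw [Finset.card_insert_of_notMem hiS, hS])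
  have h2 := hle (k + 1) (by omega) (T.erase i) (by rw [Finset.card_erase_of_mem hiT, hT]; rfl)
  rw [Finset.sum_insert hiS] at h1
  have h3 := Finset.add_sum_erase T e hiT
  omega

theorem pmFin_eq_zero_iff (h : PencilRegular n A B) :
    pmFin n A B z = 0 ↔ ¬ (pencilPoly n A B).IsRoot z := by
  have hroot : ¬ (pencilPoly n A B).IsRoot z ↔ minorOrder n n A B z = 0 := by
    rw [minorOrder_card_of_regular h, Nat.cast_eq_zero, rootMultiplicity_eq_zero_iff]
    exact ⟨fun h1 h2 => absurd h2 h1, fun h1 h2 => h (h1 h2)⟩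
  rw [hroot, pmFin, Multiset.filter_eq_nil]
  simp only [Multiset.mem_map, Multiset.mem_range, forall_exists_index, and_imp,
    forall_apply_eq_imp_iff₂, not_lt, Nat.le_zero]
  refine ⟨fun hd => ?_, fun h0 k hk => ?_⟩
  · have : ∀ k ≤ n, minorOrder n k A B z = 0 := by
      intro k
      induction k with
      | zero => exact fun _ => minorOrder_zero
      | succ k ih =>
        intro hk
        have h1 := hd k (by omega)
        rw [ih (by omega), tsub_zero, ENat.toNat_eq_zero] at h1
        exact h1.resolve_right (minorOrder_ne_top h hk)
    exact this n le_rfl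
  · have : minorOrder n (k + 1) A B z = 0 :=
      le_antisymm (h0 ▸ minorOrder_mono (by omega)) zero_le
    simp [this]

end MinorOrder

section Perturbation

variable {n k : ℕ} {A B : Matrix (Fin n) (Fin n) ℂ} {z : ℂ} {J : Type*}

theorem pencil_add {R : Type*} [CommRing R] (A B E F : Matrix (Fin n) (Fin n) R) :
    pencil (A + E) (B + F) = pencil A B + pencil E F := by
  simp only [pencil, Matrix.map_add C (fun _ _ => C_add), smul_add]
  abel

theorem pencil_map {R S : Type*} [CommRing R] [CommRing S] (φ : R →+* S)
    (A B : Matrix (Fin n) (Fin n) R) :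
    (pencil A B).map (mapRingHom φ) = pencil (A.map φ) (B.map φ) := by
  ext1 i j
  simp [pencil]

theorem pencil_vecMulVec_zero {R : Type*} [CommRing R] (x y : Fin n → R) :
    pencil (vecMulVec x y) 0 = vecMulVec (fun i => C (x i)) (fun i => C (y i)) := by
  ext1 i j
  simp [pencil, vecMulVec_apply]

/-- A perturbation of rank at most `r` shifts the orders of the minors by at most `r`. -/
theorem minorOrder_sub_card_le (E F : Matrix (Fin n) (Fin n) ℂ) (s : Finset J)
    (x w : J → Fin n → ℂ[X]) (hE : pencil E F = ∑ j ∈ s, vecMulVec (x j) (w j)) :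
    minorOrder n (k - s.card) A B z ≤ minorOrder n k (A + E) (B + F) z := by
  rcases le_total s.card k with hk | hk
  · refine minorOrder_le_of_dvd fun m h => ?_
    rw [pencil_add, hE]
    have := h.add_sum s x w
    rwa [Nat.sub_add_cancel hk] at this
  · rw [Nat.sub_eq_zero_of_le hk, minorOrder_zero]
    exact zero_le

theorem exists_rankOne_minorOrder_le (hk : k < n) :
    ∃ x y : Fin n → ℂ, minorOrder n (k + 1) (A + vecMulVec x y) B z ≤ minorOrder n k A B z := by
  by_cases htop : minorOrder n k A B z = ⊤
  · exact ⟨0, 0, htop ▸ le_top⟩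
  obtain ⟨m, hm⟩ := ENat.ne_top_iff_exists.mp htop
  rw [← hm]
  have h1 := minorOrder_le_iff.mp hm.ge
  unfold MinorsDvd at h1
  push Not at h1
  obtain ⟨f, g, hfg⟩ := h1
  have hout : ∀ f : Fin k → Fin n, ∃ p, ∀ i, f i ≠ p := by
    intro f
    by_contra! hcon
    have := Fintype.card_le_of_surjective f hcon
    simp at this
    omega
  obtain ⟨p, hp⟩ := hout f
  obtain ⟨q, hq⟩ := hout g
  by_contra! hcon
  have h2 := hcon 0 0
  have h3 := hcon (Pi.single p 1) (Pi.single q 1)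
  rw [← not_le, minorOrder_le_iff, not_not] at h2 h3
  have h2' := h2 (Fin.cons p f : Fin (k + 1) → Fin n) (Fin.cons q g : Fin (k + 1) → Fin n)
  have h3' := h3 (Fin.cons p f : Fin (k + 1) → Fin n) (Fin.cons q g : Fin (k + 1) → Fin n)
  rw [vecMulVec_zero, add_zero] at h2'
  rw [← add_zero B, pencil_add, pencil_vecMulVec_zero] at h3'
  have hs : (pencil A B + vecMulVec (fun i => C ((Pi.single p 1 : Fin n → ℂ) i))
        (fun i => C ((Pi.single q 1 : Fin n → ℂ) i))).submatrix
        (Fin.cons p f : Fin (k + 1) → Fin n) (Fin.cons q g : Fin (k + 1) → Fin n)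
      = (pencil A B).submatrix (Fin.cons p f : Fin (k + 1) → Fin n)
          (Fin.cons q g : Fin (k + 1) → Fin n)
        + vecMulVec (Pi.single 0 1) (Pi.single 0 1) := by
    ext1 i j
    simp only [submatrix_apply, Matrix.add_apply, vecMulVec_apply]
    congr 2
    · refine Fin.cases ?_ (fun i => ?_) i
      · simp
      · simp [hp]
    · refine Fin.cases ?_ (fun j => ?_) j
      · simp
      · simp [hq]
  rw [hs, det_add_vecMulVec, Finset.sum_eq_single 0 (by intro i _ hi; simp [hi]) (by simp),
    Pi.single_eq_same, one_mul] at h3'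
  have h4 := (dvd_add_right h2').mp h3'
  rw [det_succ_row_zero, Finset.sum_eq_single 0 (by intro i _ hi; simp [hi]) (by simp)] at h4
  have h5 : (((pencil A B).submatrix (Fin.cons p f : Fin (k + 1) → Fin n)
      (Fin.cons q g : Fin (k + 1) → Fin n)).updateRow 0 (Pi.single 0 1)).submatrix Fin.succ
        (Fin.succAbove 0) = (pencil A B).submatrix f g := by
    ext1 i j
    simp [updateRow_apply]
  rw [h5] at h4
  apply hfg
  simpa using h4

theorem exists_sum_minorOrder_le (s : Finset J) (hk : k ≤ n) :
    ∃ x w : J → Fin n → ℂ, minorOrder n k (A + ∑ j ∈ s, vecMulVec (x j) (w j)) B z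
      ≤ minorOrder n (k - s.card) A B z := by
  classical
  induction s using Finset.induction_on generalizing k with
  | empty => exact ⟨0, 0, by simp⟩
  | insert a s ha ih =>
    cases k with
    | zero => exact ⟨0, 0, by simp [minorOrder_zero]⟩
    | succ k =>
      obtain ⟨x, w, hxw⟩ := ih (k := k) (by omega)
      obtain ⟨x', w', hxw'⟩ := exists_rankOne_minorOrder_le
        (A := A + ∑ j ∈ s, vecMulVec (x j) (w j)) (B := B) (z := z) (Nat.lt_of_succ_le hk)
      refine ⟨Function.update x a x', Function.update w a w', ?_⟩
      rw [Finset.sum_insert ha, Finset.card_insert_of_notMem ha, Function.update_self,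
        Function.update_self, Nat.add_sub_add_right, add_comm (vecMulVec _ _), ← add_assoc,
        Finset.sum_congr rfl (g := fun j => vecMulVec (x j) (w j))]
      · exact hxw'.trans hxw
      · intro j hj
        rw [Function.update_of_ne (ne_of_mem_of_not_mem hj ha),
          Function.update_of_ne (ne_of_mem_of_not_mem hj ha)]

end Perturbation

section Family

variable {n k : ℕ} {A B : Matrix (Fin n) (Fin n) ℂ} {z : ℂ} {ι : Type*}
  {FA FB : Matrix (Fin n) (Fin n) (MvPolynomial ι ℂ)}

theorem map_eval_pencil_det (A B : Matrix (Fin n) (Fin n) ℂ)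
    (FA FB : Matrix (Fin n) (Fin n) (MvPolynomial ι ℂ)) (f g : Fin k → Fin n) (y : ι → ℂ) :
    (((pencil (A.map MvPolynomial.C + FA) (B.map MvPolynomial.C + FB)).submatrix f g).det).map
        (MvPolynomial.eval y)
      = ((pencil (A + FA.map (MvPolynomial.eval y))
          (B + FB.map (MvPolynomial.eval y))).submatrix f g).det := by
  have hev : ∀ (A : Matrix (Fin n) (Fin n) ℂ) (F : Matrix (Fin n) (Fin n) (MvPolynomial ι ℂ)),
      (A.map MvPolynomial.C + F).map (MvPolynomial.eval y) = A + F.map (MvPolynomial.eval y) := by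
    intro A F
    ext i j
    simp
  rw [← coe_mapRingHom, RingHom.map_det, RingHom.mapMatrix_apply, ← submatrix_map, pencil_map,
    hev, hev]

/-- An upper bound for the order of the minors that holds at one parameter holds generically. -/
theorem exists_generic_minorOrder_le {m : ℕ∞} {y₀ : ι → ℂ}
    (h : minorOrder n k (A + FA.map (MvPolynomial.eval y₀))
      (B + FB.map (MvPolynomial.eval y₀)) z ≤ m) :
    ∃ c : MvPolynomial ι ℂ, c ≠ 0 ∧ ∀ y : ι → ℂ, MvPolynomial.eval y c ≠ 0 →
      minorOrder n k (A + FA.map (MvPolynomial.eval y))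
        (B + FB.map (MvPolynomial.eval y)) z ≤ m := by
  by_cases htop : m = ⊤
  · exact ⟨1, one_ne_zero, fun y _ => htop ▸ le_top⟩
  obtain ⟨m, rfl⟩ := ENat.ne_top_iff_exists.mp htop
  have h1 := minorOrder_le_iff.mp h
  unfold MinorsDvd at h1
  push Not at h1
  obtain ⟨f, g, hfg⟩ := h1
  rw [X_sub_C_pow_dvd_iff, X_pow_dvd_iff] at hfg
  push Not at hfg
  obtain ⟨j, hj, hj'⟩ := hfg
  let c := ((((pencil (A.map MvPolynomial.C + FA) (B.map MvPolynomial.C + FB)).submatrix f g).det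
    ).comp (X + C (MvPolynomial.C z))).coeff j
  have hc : ∀ y, MvPolynomial.eval y c
      = ((((pencil (A + FA.map (MvPolynomial.eval y))
          (B + FB.map (MvPolynomial.eval y))).submatrix f g).det).comp (X + C z)).coeff j := by
    intro y
    rw [← coeff_map, Polynomial.map_comp, map_eval_pencil_det]
    simp
  refine ⟨c, fun h0 => hj' ?_, fun y hy => ?_⟩
  · rw [← hc, h0, map_zero]
  · rw [minorOrder_le_iff]
    intro hcon
    have := hcon f g
    rw [X_sub_C_pow_dvd_iff, X_pow_dvd_iff] at this
    exact hy ((hc y).trans (this j hj))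

/-- Generic upper bound for the orders of the minors in a family of perturbations that contains
all constant matrices `∑ⱼ xⱼ wⱼᵀ`. -/
theorem exists_generic_minorOrder_le_sub {J : Type*} [Fintype J]
    (hfam : ∀ x w : J → Fin n → ℂ, ∃ y : ι → ℂ,
      FA.map (MvPolynomial.eval y) = ∑ j, vecMulVec (x j) (w j) ∧
      FB.map (MvPolynomial.eval y) = 0) (z : ℂ) (hk : k ≤ n) :
    ∃ c : MvPolynomial ι ℂ, c ≠ 0 ∧ ∀ y : ι → ℂ, MvPolynomial.eval y c ≠ 0 →
      minorOrder n k (A + FA.map (MvPolynomial.eval y)) (B + FB.map (MvPolynomial.eval y)) z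
        ≤ minorOrder n (k - Fintype.card J) A B z := by
  obtain ⟨x, w, hxw⟩ := exists_sum_minorOrder_le (A := A) (B := B) (z := z)
    (Finset.univ : Finset J) hk
  obtain ⟨y₀, h1, h2⟩ := hfam x w
  refine exists_generic_minorOrder_le (y₀ := y₀) ?_
  rw [h1, h2, add_zero]
  exact hxw

/-- Finitely many nonvanishing conditions can be combined into one. -/
theorem exists_generic_forall {α ι : Type*} (s : Finset α) {P : α → (ι → ℂ) → Prop}
    (h : ∀ a ∈ s, ∃ c : MvPolynomial ι ℂ, c ≠ 0 ∧ ∀ y, MvPolynomial.eval y c ≠ 0 → P a y) :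
    ∃ c : MvPolynomial ι ℂ, c ≠ 0 ∧ ∀ y, MvPolynomial.eval y c ≠ 0 → ∀ a ∈ s, P a y := by
  classical
  choose! c hc hcP using h
  refine ⟨∏ a ∈ s, c a, Finset.prod_ne_zero_iff.mpr hc, fun y hy a ha => hcP a ha y ?_⟩
  rw [map_prod] at hy
  exact Finset.prod_ne_zero_iff.mp hy a ha

theorem exists_generic_and {ι : Type*} {P Q : (ι → ℂ) → Prop}
    (hP : ∃ c : MvPolynomial ι ℂ, c ≠ 0 ∧ ∀ y, MvPolynomial.eval y c ≠ 0 → P y)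
    (hQ : ∃ c : MvPolynomial ι ℂ, c ≠ 0 ∧ ∀ y, MvPolynomial.eval y c ≠ 0 → Q y) :
    ∃ c : MvPolynomial ι ℂ, c ≠ 0 ∧ ∀ y, MvPolynomial.eval y c ≠ 0 → P y ∧ Q y := by
  obtain ⟨c, hc, hcP⟩ := hP
  obtain ⟨d, hd, hdQ⟩ := hQ
  refine ⟨c * d, mul_ne_zero hc hd, fun y hy => ?_⟩
  rw [map_mul] at hy
  exact ⟨hcP y (left_ne_zero_of_mul hy), hdQ y (right_ne_zero_of_mul hy)⟩

/-- A nonvanishing condition over `ℂ` defines a generic set of real parameters. -/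
theorem isGenericR_of_eval_ne_zero {ι : Type} [Fintype ι] {c : MvPolynomial ι ℂ} (hc : c ≠ 0) :
    IsGenericR ι {y | MvPolynomial.eval (fun i => (y i : ℂ)) c ≠ 0} := by
  classical
  have hsplit : ∀ c : MvPolynomial ι ℂ, ∃ p q : MvPolynomial ι ℝ,
      c = MvPolynomial.map Complex.ofRealHom p
        + MvPolynomial.C Complex.I * MvPolynomial.map Complex.ofRealHom q := by
    intro c
    induction c using MvPolynomial.induction_on with
    | C a =>
      refine ⟨MvPolynomial.C a.re, MvPolynomial.C a.im, ?_⟩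
      rw [MvPolynomial.map_C, MvPolynomial.map_C, ← map_mul, ← map_add]
      congr 1
      rw [mul_comm]
      exact (Complex.re_add_im a).symm
    | add c d hc hd =>
      obtain ⟨p, q, hpq⟩ := hc
      obtain ⟨p', q', hpq'⟩ := hd
      refine ⟨p + p', q + q', ?_⟩
      rw [hpq, hpq', map_add, map_add]
      ring
    | mul_X c i hc =>
      obtain ⟨p, q, hpq⟩ := hc
      refine ⟨p * MvPolynomial.X i, q * MvPolynomial.X i, ?_⟩
      rw [hpq, map_mul, map_mul, MvPolynomial.map_X]
      ring
  obtain ⟨p, q, hpq⟩ := hsplit c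
  refine ⟨{p, q}, ?_, fun y hy => ?_⟩
  · by_contra! hcon
    apply hc
    rw [hpq, hcon p (by simp), hcon q (by simp)]
    simp
  · have hev : ∀ p : MvPolynomial ι ℝ,
        MvPolynomial.eval (fun i => (y i : ℂ)) (MvPolynomial.map Complex.ofRealHom p)
          = (MvPolynomial.eval y p : ℂ) := by
      intro p
      rw [MvPolynomial.eval_map]
      exact (MvPolynomial.eval₂_comp_left Complex.ofRealHom (RingHom.id ℝ) y p).symm
    simp only [Set.mem_compl_iff, Set.mem_ofPred_eq, not_not] at hy
    rw [hpq, map_add, map_mul, MvPolynomial.eval_C, hev, hev] at hy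
    have hre := congrArg Complex.re hy
    have him := congrArg Complex.im hy
    simp at hre him
    intro r hr
    rcases Finset.mem_insert.mp hr with rfl | hr
    · exact hre
    · rw [Finset.mem_singleton.mp hr]
      exact him

end Family

/-- In a linear system spanned by `g` and `h`, only finitely many members have a multiple root
outside the roots of `g`. -/
theorem finite_setOf_multiple_root {g : ℂ[X]} (hg : g ≠ 0) (h : ℂ[X]) :
    {t : ℂ | ∃ z, g.eval z ≠ 0 ∧ 1 < (g + C t * h).rootMultiplicity z}.Finite := by
  have hroots : ∀ t z, 1 < (g + C t * h).rootMultiplicity z →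
      g + C t * h ≠ 0 ∧ g.eval z + t * h.eval z = 0 ∧
        (derivative g).eval z + t * (derivative h).eval z = 0 := by
    intro t z hz
    have hne : g + C t * h ≠ 0 := by
      intro h0
      rw [h0, rootMultiplicity_zero] at hz
      exact absurd hz (by norm_num)
    have := (one_lt_rootMultiplicity_iff_isRoot hne).mp hz
    simpa [IsRoot, hne] using this
  by_cases hW : wronskian g h = 0
  · obtain ⟨q, g₁, h₁, hcop, hg₁, hh₁⟩ : ∃ q g₁ h₁ : ℂ[X], IsCoprime g₁ h₁ ∧
        g = q * g₁ ∧ h = q * h₁ := by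
      classical
      let _ := EuclideanDomain.gcdMonoid ℂ[X]
      exact ⟨GCDMonoid.gcd h g, _, _, (isCoprime_div_gcd_div_gcd hg).symm,
        (EuclideanDomain.mul_div_cancel' (gcd_ne_zero_of_right hg) (gcd_dvd_right h g)).symm,
        (EuclideanDomain.mul_div_cancel' (gcd_ne_zero_of_right hg) (gcd_dvd_left h g)).symm⟩
    have hq : q ≠ 0 := fun h0 => hg (by rw [hg₁, h0, zero_mul])
    have hW' : q ^ 2 * wronskian g₁ h₁ = 0 := by
      rw [← hW, hg₁, hh₁]
      simp only [wronskian, derivative_mul]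
      ring
    have hW₁ := (mul_eq_zero.mp hW').resolve_left (pow_ne_zero 2 hq)
    obtain ⟨hg', hh'⟩ := hcop.wronskian_eq_zero_iff.mp hW₁
    have hgC := eq_C_of_derivative_eq_zero hg'
    have hhC := eq_C_of_derivative_eq_zero hh'
    set a := g₁.coeff 0
    set b := h₁.coeff 0
    have ha : a ≠ 0 := by
      intro h0
      apply hg
      rw [hg₁, hgC, h0, C_0, mul_zero]
    convert Set.finite_empty
    rw [Set.eq_empty_iff_forall_notMem]
    rintro t ⟨z, hz, hz'⟩
    obtain ⟨hne, h1, -⟩ := hroots t z hz'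
    have hsum : g + C t * h = C (a + t * b) * q := by
      conv_lhs => rw [hg₁, hh₁, hgC, hhC]
      simp only [C_add, C_mul]
      ring
    have hq0 : q.eval z ≠ 0 := by
      intro h0
      apply hz
      rw [hg₁, eval_mul, h0, zero_mul]
    have hev := congrArg (eval z) hsum
    rw [eval_add, eval_mul, eval_C, h1, eval_mul, eval_C] at hev
    apply hne
    rw [hsum, (mul_eq_zero.mp hev.symm).resolve_right hq0, C_0, zero_mul]
  · refine ((wronskian g h).roots.toFinset.finite_toSet.image
      fun z => -g.eval z / h.eval z).subset ?_
    rintro t ⟨z, hz, hz'⟩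
    obtain ⟨-, h1, h2⟩ := hroots t z hz'
    have hh : h.eval z ≠ 0 := by
      intro h0
      rw [h0, mul_zero, add_zero] at h1
      exact hz h1
    refine ⟨z, ?_, ?_⟩
    · rw [Finset.mem_coe, Multiset.mem_toFinset, mem_roots hW]
      simp only [IsRoot, wronskian, eval_sub, eval_mul]
      linear_combination (derivative h).eval z * h1 - h.eval z * h2
    · change -g.eval z / h.eval z = t
      rw [div_eq_iff hh]
      linear_combination -h1

section Simple

variable {n : ℕ} {A B : Matrix (Fin n) (Fin n) ℂ}

theorem natDegree_pencilPoly_le : (pencilPoly n A B).natDegree ≤ n := by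
  have := natDegree_det_X_add_C_le B A
  rwa [Fintype.card_fin, add_comm] at this

theorem coeff_pencilPoly : (pencilPoly n A B).coeff n = B.det := by
  have := coeff_det_X_add_C_card B A
  rwa [Fintype.card_fin, add_comm] at this

theorem eval_pencilPoly (z : ℂ) : (pencilPoly n A B).eval z = (A + z • B).det := by
  rw [pencilPoly, ← coe_evalRingHom, RingHom.map_det]
  congr 1
  ext i j
  simp
  exact mul_comm _ _

theorem pencilRegular_of_det_ne_zero (hB : B.det ≠ 0) : PencilRegular n A B := by
  intro h
  rw [← coeff_pencilPoly (A := A), h, coeff_zero] at hB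
  exact hB rfl

theorem exists_pencilPoly_add_smul (x y : Fin n → ℂ) :
    ∃ h : ℂ[X], ∀ t : ℂ,
      pencilPoly n (A + vecMulVec (t • x) y) B = pencilPoly n A B + C t * h := by
  refine ⟨∑ i, C (x i) * ((pencil A B).updateRow i fun j => C (y j)).det, fun t => ?_⟩
  rw [pencilPoly_eq_det_pencil, pencilPoly_eq_det_pencil]
  conv_lhs => rw [← add_zero B]
  rw [pencil_add, pencil_vecMulVec_zero, det_add_vecMulVec, Finset.mul_sum]
  simp [mul_assoc]

/-- Some rank-one perturbation has the expected orders at finitely many given points, and only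
simple eigenvalues elsewhere. -/
theorem exists_rankOne_simple (h : PencilRegular n A B) (Z : Finset ℂ)
    (hZ : ∀ z, (pencilPoly n A B).IsRoot z → z ∈ Z) :
    ∃ x y : Fin n → ℂ,
      (∀ z ∈ Z, ∀ k < n,
        minorOrder n (k + 1) (A + vecMulVec x y) B z ≤ minorOrder n k A B z) ∧
      ∀ z ∉ Z, (pencilPoly n (A + vecMulVec x y) B).rootMultiplicity z ≤ 1 := by
  let FA : Matrix (Fin n) (Fin n) (MvPolynomial (Fin n ⊕ Fin n) ℂ) :=
    vecMulVec (fun i => MvPolynomial.X (Sum.inl i)) (fun j => MvPolynomial.X (Sum.inr j))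
  have hFA : ∀ x y : Fin n → ℂ, FA.map (MvPolynomial.eval (Sum.elim x y)) = vecMulVec x y := by
    intro x y
    ext i j
    simp [FA, vecMulVec_apply]
  obtain ⟨c, hc, hcP⟩ := exists_generic_forall (Z ×ˢ Finset.range n)
    (P := fun a y => minorOrder n (a.2 + 1) (A + FA.map (MvPolynomial.eval y)) B a.1
      ≤ minorOrder n a.2 A B a.1) (by
    rintro ⟨z, k⟩ ha
    have hk : k + 1 ≤ n := by simpa using (Finset.mem_product.mp ha).2
    obtain ⟨c, hc, hcP⟩ := exists_generic_minorOrder_le_sub (J := Unit) (A := A) (B := B)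
      (FA := FA) (FB := 0)
      (fun x w => ⟨Sum.elim (x ()) (w ()), by simp [hFA], by simp⟩) z hk
    exact ⟨c, hc, fun y hy => by simpa using hcP y hy⟩)
  obtain ⟨y₀, hy₀⟩ : ∃ y₀, MvPolynomial.eval y₀ c ≠ 0 := by
    by_contra! hcon
    exact hc (MvPolynomial.funext fun y => by rw [hcon, map_zero])
  set x := y₀ ∘ Sum.inl
  set y := y₀ ∘ Sum.inr
  let P : ℂ[X] := MvPolynomial.aeval (Sum.elim (fun i => X * C (x i)) (fun j => C (y j))) c
  have hP : ∀ t, P.eval t = MvPolynomial.eval (Sum.elim (t • x) y) c := by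
    intro t
    have h1 : (MvPolynomial.eval (Sum.elim (t • x) y) : MvPolynomial _ ℂ →+* ℂ)
        = (evalRingHom t).comp (MvPolynomial.aeval (R := ℂ)
          (Sum.elim (fun i => X * C (x i)) (fun j => C (y j)))).toRingHom := by
      refine MvPolynomial.ringHom_ext (by simp) ?_
      rintro (i | j)
      · simp
        exact mul_comm _ _
      · simp
    rw [h1]
    rfl
  have hP0 : P ≠ 0 := by
    intro h0
    apply hy₀
    have := hP 1
    rw [h0, eval_zero, one_smul, Sum.elim_comp_inl_inr] at this
    exact this.symm
  obtain ⟨q, hq⟩ := exists_pencilPoly_add_smul (A := A) (B := B) x y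
  obtain ⟨t, ht⟩ := ((finite_setOf_multiple_root h q).union
    P.roots.toFinset.finite_toSet).infinite_compl.nonempty
  simp only [Set.mem_compl_iff, Set.mem_union, not_or, Finset.mem_coe, Multiset.mem_toFinset,
    mem_roots hP0, IsRoot, hP] at ht
  refine ⟨t • x, y, fun z hz k hk => ?_, fun z hz => ?_⟩
  · have := hcP _ ht.2 (z, k) (by simp [hz, hk])
    rwa [hFA] at this
  · by_contra! hcon
    rw [hq] at hcon
    exact ht.1 ⟨z, fun h0 => hz (hZ z h0), hcon⟩

theorem minorOrder_pred_eq_zero {n : ℕ} {A B : Matrix (Fin (n + 1)) (Fin (n + 1)) ℂ} {z : ℂ}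
    (h : minorOrder (n + 1) (n + 1) A B z ≤ 1) : minorOrder (n + 1) n A B z = 0 := by
  refine le_antisymm (minorOrder_le_iff.mpr fun hcon => ?_) zero_le
  rw [zero_add, pow_one] at hcon
  have := sq_dvd_det_of_minorsDvd (prime_X_sub_C z) hcon
  exact (minorOrder_le_iff (m := 1)).mp h (minorsDvd_card_iff.mpr this)

/-- Some perturbation of rank at most `#s` has the expected orders at finitely many given points,
and only simple eigenvalues elsewhere. -/
theorem exists_sum_simple {J : Type*} (hB : B.det ≠ 0) (Z : Finset ℂ)
    (hZ : ∀ z, (pencilPoly n A B).IsRoot z → z ∈ Z) (s : Finset J) :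
    ∃ x w : J → Fin n → ℂ,
      (∀ z ∈ Z, ∀ k ≤ n, minorOrder n k (A + ∑ j ∈ s, vecMulVec (x j) (w j)) B z
        ≤ minorOrder n (k - s.card) A B z) ∧
      ∀ z ∉ Z,
        (pencilPoly n (A + ∑ j ∈ s, vecMulVec (x j) (w j)) B).rootMultiplicity z ≤ 1 := by
  classical
  induction s using Finset.induction_on with
  | empty =>
    refine ⟨0, 0, by simp, fun z hz => ?_⟩
    rw [Finset.sum_empty, add_zero, rootMultiplicity_eq_zero fun h0 => hz (hZ z h0)]
    exact zero_le_one
  | insert a s ha ih =>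
    obtain ⟨x, w, h1, h2⟩ := ih
    set A' := A + ∑ j ∈ s, vecMulVec (x j) (w j) with hA'
    have hreg : PencilRegular n A' B := pencilRegular_of_det_ne_zero hB
    obtain ⟨x', w', h3, h4⟩ := exists_rankOne_simple hreg
      (Z ∪ (pencilPoly n A' B).roots.toFinset) (fun z hz => by
        rw [Finset.mem_union, Multiset.mem_toFinset, mem_roots hreg]
        exact Or.inr hz)
    have hsum : A + ∑ j ∈ insert a s, vecMulVec (Function.update x a x' j)
        (Function.update w a w' j) = A' + vecMulVec x' w' := by
      rw [Finset.sum_insert ha, Function.update_self, Function.update_self,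
        add_comm (vecMulVec _ _), ← add_assoc,
        Finset.sum_congr rfl (g := fun j => vecMulVec (x j) (w j))]
      intro j hj
      rw [Function.update_of_ne (ne_of_mem_of_not_mem hj ha),
        Function.update_of_ne (ne_of_mem_of_not_mem hj ha)]
    refine ⟨Function.update x a x', Function.update w a w', fun z hz k hk => ?_, fun z hz => ?_⟩
    · rw [hsum, Finset.card_insert_of_notMem ha]
      cases k with
      | zero => simp [minorOrder_zero]
      | succ k =>
        rw [Nat.add_sub_add_right]
        exact (h3 z (Finset.mem_union_left _ hz) k hk).trans (h1 z hz k (by omega))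
    · rw [hsum]
      by_cases hz' : z ∈ Z ∪ (pencilPoly n A' B).roots.toFinset
      · cases n with
        | zero => simp [pencilPoly, rootMultiplicity_eq_zero (p := (1 : ℂ[X]))]
        | succ n =>
          have h5 := h3 z hz' n (Nat.lt_succ_self n)
          rw [minorOrder_pred_eq_zero (by
            rw [minorOrder_card_of_regular hreg]
            exact_mod_cast h2 z hz),
            minorOrder_card_of_regular (pencilRegular_of_det_ne_zero hB)] at h5
          have h6 : (pencilPoly (n + 1) (A' + vecMulVec x' w') B).rootMultiplicity z ≤ 0 := by
            exact_mod_cast h5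
          exact h6.trans zero_le_one
      · exact h4 z hz'

theorem isCoprime_derivative_iff {p : ℂ[X]} (hp : p ≠ 0) :
    IsCoprime p (derivative p) ↔ ∀ z, p.rootMultiplicity z ≤ 1 := by
  rw [← Separable, ← nodup_roots_iff_of_splits hp (IsAlgClosed.splits p),
    Multiset.nodup_iff_count_le_one]
  simp only [count_roots]

/-- Generic simplicity of the roots that are not forced by a common divisor `q`. -/
theorem exists_generic_rootMultiplicity_le {ι : Type*} (F : (MvPolynomial ι ℂ)[X]) {q : ℂ[X]}
    (hq : q.Monic) (hdvd : ∀ y, q ∣ F.map (MvPolynomial.eval y))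
    (hdeg : ∀ y, (F.map (MvPolynomial.eval y)).natDegree ≤ n) {y₀ : ι → ℂ}
    (hy₀ : (F.map (MvPolynomial.eval y₀)).coeff n ≠ 0)
    (hmult : ∀ z, (F.map (MvPolynomial.eval y₀)).rootMultiplicity z
      ≤ q.rootMultiplicity z + 1) :
    ∃ c : MvPolynomial ι ℂ, c ≠ 0 ∧ ∀ y, MvPolynomial.eval y c ≠ 0 →
      ∀ z, (F.map (MvPolynomial.eval y)).rootMultiplicity z ≤ q.rootMultiplicity z + 1 := by
  let p : (MvPolynomial ι ℂ)[X] := F /ₘ q.map MvPolynomial.C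
  have hqy : ∀ y : ι → ℂ, (q.map MvPolynomial.C).map (MvPolynomial.eval y) = q := by
    intro y
    rw [Polynomial.map_map]
    convert Polynomial.map_id
    ext1 a
    simp
  have hpy : ∀ y, F.map (MvPolynomial.eval y) = q * p.map (MvPolynomial.eval y) := by
    intro y
    rw [map_divByMonic _ (hq.map _), hqy]
    conv_lhs => rw [← modByMonic_add_div (F.map (MvPolynomial.eval y)) q]
    rw [(modByMonic_eq_zero_iff_dvd hq).mpr (hdvd y), zero_add]
  let d := n - q.natDegree
  have hres : ∀ y, (F.map (MvPolynomial.eval y)).coeff n ≠ 0 →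
      (MvPolynomial.eval y (resultant p (derivative p) d (d - 1)) ≠ 0 ↔
        ∀ z, (F.map (MvPolynomial.eval y)).rootMultiplicity z ≤ q.rootMultiplicity z + 1) := by
    intro y hy
    have hF0 : F.map (MvPolynomial.eval y) ≠ 0 := by
      intro h0
      rw [h0, coeff_zero] at hy
      exact hy rfl
    have hFdeg : (F.map (MvPolynomial.eval y)).natDegree = n :=
      le_antisymm (hdeg y) (le_natDegree_of_ne_zero hy)
    rw [hpy] at hF0 hFdeg
    have hp0 := right_ne_zero_of_mul hF0
    have hpdeg : (p.map (MvPolynomial.eval y)).natDegree = d := by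
      rw [natDegree_mul hq.ne_zero hp0] at hFdeg
      omega
    have hpdeg' : (derivative (p.map (MvPolynomial.eval y))).natDegree = d - 1 := by
      rw [← hpdeg]
      exact natDegree_derivative _
    have h1 := resultant_eq_zero_iff (f := p.map (MvPolynomial.eval y))
      (g := derivative (p.map (MvPolynomial.eval y)))
    have h2 : resultant (p.map (MvPolynomial.eval y)) (derivative (p.map (MvPolynomial.eval y)))
        d (d - 1) = MvPolynomial.eval y (resultant p (derivative p) d (d - 1)) := by
      rw [derivative_map, resultant_map_map]
    rw [hpdeg, hpdeg', h2] at h1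
    rw [Ne, h1]
    simp only [hp0, ne_eq, not_false_eq_true, true_or, true_and, not_not]
    rw [isCoprime_derivative_iff hp0, hpy]
    simp only [rootMultiplicity_mul hF0, add_le_add_iff_left]
  refine ⟨F.coeff n * resultant p (derivative p) d (d - 1), fun h0 => ?_, fun y hy => ?_⟩
  · have h1 := (hres y₀ hy₀).mpr hmult
    have h2 := congrArg (MvPolynomial.eval y₀) h0
    rw [coeff_map] at hy₀
    rw [map_mul, map_zero] at h2
    exact mul_ne_zero hy₀ h1 h2
  · rw [map_mul] at hy
    exact (hres y (by rw [coeff_map]; exact left_ne_zero_of_mul hy)).mp (right_ne_zero_of_mul hy)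

end Simple

/-- A polynomial family of pencils `FA + λ FB` whose members are sums of `#J` rank-one pencils, and
which contains all pencils `(α + λ β) ∑ j, x j (w j)ᵀ`. -/
def IsRankFamily {ι : Type*} {n : ℕ} (J : Type*) [Fintype J]
    (FA FB : Matrix (Fin n) (Fin n) (MvPolynomial ι ℂ)) : Prop :=
  (∀ (y : ι → ℂ) (p q : ℂ[X]), ∃ x w : J → Fin n → ℂ[X],
    p • (FA.map (MvPolynomial.eval y)).map C + q • (FB.map (MvPolynomial.eval y)).map C
      = ∑ j, vecMulVec (x j) (w j)) ∧
  ∀ (x w : J → Fin n → ℂ) (α β : ℂ), ∃ y : ι → ℂ,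
    FA.map (MvPolynomial.eval y) = α • ∑ j, vecMulVec (x j) (w j) ∧
    FB.map (MvPolynomial.eval y) = β • ∑ j, vecMulVec (x j) (w j)

theorem eval_pencilPoly_ne_zero_iff {n : ℕ} {A B : Matrix (Fin n) (Fin n) ℂ} {z : ℂ} :
    (pencilPoly n A B).eval z ≠ 0 ↔ minorOrder n n A B z ≤ 0 := by
  have := minorOrder_le_iff (n := n) (k := n) (A := A) (B := B) (z := z) (m := 0)
  rw [Nat.cast_zero] at this
  rw [this, zero_add, pow_one, minorsDvd_card_iff, dvd_iff_isRoot]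
  rfl

theorem PencilRegular.exists_eval_ne_zero {n : ℕ} {A B : Matrix (Fin n) (Fin n) ℂ}
    (h : PencilRegular n A B) : ∃ c, (pencilPoly n A B).eval c ≠ 0 := by
  by_contra! hcon
  exact h (Polynomial.funext fun z => by rw [hcon, eval_zero])

theorem pencilRegular_of_eval_ne_zero {n : ℕ} {A B : Matrix (Fin n) (Fin n) ℂ} {z : ℂ}
    (h : (pencilPoly n A B).eval z ≠ 0) : PencilRegular n A B := by
  intro h0
  rw [h0, eval_zero] at h
  exact h rfl

theorem eval_pencilPoly_moebius {n : ℕ} (A B : Matrix (Fin n) (Fin n) ℂ) (c : ℂ) {t : ℂ}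
    (ht : t ≠ 0) :
    (pencilPoly n B (A + c • B)).eval t = t ^ n * (pencilPoly n A B).eval (c + t⁻¹) := by
  rw [eval_pencilPoly, eval_pencilPoly]
  have : B + t • (A + c • B) = t • (A + (c + t⁻¹) • B) := by
    rw [smul_add, smul_add, smul_smul, smul_smul, mul_add, mul_inv_cancel₀ ht, add_smul, one_smul]
    abel
  rw [this, det_smul, Fintype.card_fin]

theorem one_lt_rootMultiplicity_moebius {n : ℕ} {A B : Matrix (Fin n) (Fin n) ℂ} {c z : ℂ}
    (hc : (pencilPoly n A B).eval c ≠ 0) (hz : 1 < (pencilPoly n A B).rootMultiplicity z) :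
    z ≠ c ∧ 1 < (pencilPoly n B (A + c • B)).rootMultiplicity (z - c)⁻¹ := by
  obtain ⟨h1, h2⟩ := (one_lt_rootMultiplicity_iff_isRoot (pencilRegular_of_eval_ne_zero hc)).mp hz
  have hzc : z ≠ c := by
    rintro rfl
    exact hc h1
  refine ⟨hzc, ?_⟩
  have hμ : (z - c)⁻¹ ≠ 0 := inv_ne_zero (sub_ne_zero.mpr hzc)
  have hcμ : c + ((z - c)⁻¹)⁻¹ = z := by rw [inv_inv]; ring
  rw [one_lt_rootMultiplicity_iff_isRoot (pencilRegular_of_det_ne_zero (by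
    rwa [eval_pencilPoly] at hc))]
  constructor
  · rw [IsRoot, eval_pencilPoly_moebius A B c hμ, hcμ, h1, mul_zero]
  · have h3 : HasDerivAt (fun t : ℂ => t ^ n * (pencilPoly n A B).eval (c + t⁻¹)) _ (z - c)⁻¹ :=
      (hasDerivAt_pow n _).mul (((pencilPoly n A B).hasDerivAt _).comp _
        ((hasDerivAt_inv hμ).const_add c))
    have h4 := (h3.congr_of_eventuallyEq (f₁ := fun t => (pencilPoly n B (A + c • B)).eval t)
      ((isOpen_ne.eventually_mem hμ).mono fun t ht =>
        eval_pencilPoly_moebius A B c ht)).unique ((pencilPoly n B (A + c • B)).hasDerivAt _)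
    rw [hcμ, h1, h2] at h4
    simpa using h4.symm

namespace IsRankFamily

variable {ι J : Type*} [Fintype J] {n : ℕ} {A B : Matrix (Fin n) (Fin n) ℂ}
  {FA FB : Matrix (Fin n) (Fin n) (MvPolynomial ι ℂ)}

theorem moebius (h : IsRankFamily J FA FB) (c : ℂ) :
    IsRankFamily J FB (FA + (MvPolynomial.C c : MvPolynomial ι ℂ) • FB) := by
  have hmap : ∀ y, (FA + (MvPolynomial.C c : MvPolynomial ι ℂ) • FB).map (MvPolynomial.eval y)
      = FA.map (MvPolynomial.eval y) + c • FB.map (MvPolynomial.eval y) := by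
    intro y
    ext i j
    simp
  refine ⟨fun y p q => ?_, fun x w α β => ?_⟩
  · obtain ⟨x, w, hxw⟩ := h.1 y q (p + q * C c)
    refine ⟨x, w, ?_⟩
    rw [← hxw, hmap]
    ext1 i j
    simp only [Matrix.add_apply, Matrix.smul_apply, Matrix.map_apply, smul_eq_mul, C_add, C_mul]
    ring
  · obtain ⟨y, h1, h2⟩ := h.2 x w (β - c * α) α
    refine ⟨y, h2, ?_⟩
    rw [hmap, h1, h2, smul_smul, ← add_smul, sub_add_cancel]

theorem swap (h : IsRankFamily J FA FB) : IsRankFamily J FB FA := by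
  simpa using h.moebius 0

theorem exists_pencil_eq (h : IsRankFamily J FA FB) (y : ι → ℂ) :
    ∃ x w : J → Fin n → ℂ[X], pencil (FA.map (MvPolynomial.eval y)) (FB.map (MvPolynomial.eval y))
      = ∑ j, vecMulVec (x j) (w j) := by
  simpa [pencil] using h.1 y 1 X

theorem exists_eq_sum (h : IsRankFamily J FA FB) (x w : J → Fin n → ℂ) :
    ∃ y, FA.map (MvPolynomial.eval y) = ∑ j, vecMulVec (x j) (w j) ∧
      FB.map (MvPolynomial.eval y) = 0 := by
  simpa using h.2 x w 1 0

theorem minorOrder_sub_le (h : IsRankFamily J FA FB) (y : ι → ℂ) (k : ℕ) (z : ℂ) :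
    minorOrder n (k - Fintype.card J) A B z ≤ minorOrder n k (A + FA.map (MvPolynomial.eval y))
      (B + FB.map (MvPolynomial.eval y)) z := by
  obtain ⟨x, w, hxw⟩ := h.exists_pencil_eq y
  exact minorOrder_sub_card_le _ _ Finset.univ x w hxw

theorem exists_generic_minorOrder_eq (h : IsRankFamily J FA FB) (z : ℂ) :
    ∃ c : MvPolynomial ι ℂ, c ≠ 0 ∧ ∀ y, MvPolynomial.eval y c ≠ 0 → ∀ k ≤ n,
      minorOrder n k (A + FA.map (MvPolynomial.eval y)) (B + FB.map (MvPolynomial.eval y)) z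
        = minorOrder n (k - Fintype.card J) A B z := by
  obtain ⟨c, hc, hcP⟩ := exists_generic_forall (Finset.range (n + 1)) (fun k hk =>
    exists_generic_minorOrder_le_sub (A := A) (B := B) h.exists_eq_sum z
      (Nat.lt_succ_iff.mp (Finset.mem_range.mp hk)))
  exact ⟨c, hc, fun y hy k hk => le_antisymm
    (hcP y hy k (Finset.mem_range.mpr (Nat.lt_succ_iff.mpr hk))) (h.minorOrder_sub_le y k z)⟩

theorem exists_generic_eval_ne_zero (h : IsRankFamily J FA FB) {z : ℂ}
    (hz : (pencilPoly n A B).eval z ≠ 0) :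
    ∃ c : MvPolynomial ι ℂ, c ≠ 0 ∧ ∀ y, MvPolynomial.eval y c ≠ 0 →
      (pencilPoly n (A + FA.map (MvPolynomial.eval y))
        (B + FB.map (MvPolynomial.eval y))).eval z ≠ 0 := by
  simp only [eval_pencilPoly_ne_zero_iff] at hz ⊢
  obtain ⟨y₀, h1, h2⟩ := h.2 0 0 0 0
  rw [zero_smul] at h1 h2
  exact exists_generic_minorOrder_le (y₀ := y₀) (by rwa [h1, h2, add_zero, add_zero])

theorem exists_generic_simple_of_det_ne_zero (h : IsRankFamily J FA FB) (hB : B.det ≠ 0) :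
    ∃ c : MvPolynomial ι ℂ, c ≠ 0 ∧ ∀ y, MvPolynomial.eval y c ≠ 0 →
      ∀ z, (pencilPoly n A B).eval z ≠ 0 → (pencilPoly n (A + FA.map (MvPolynomial.eval y))
        (B + FB.map (MvPolynomial.eval y))).rootMultiplicity z ≤ 1 := by
  classical
  have hreg : PencilRegular n A B := pencilRegular_of_det_ne_zero hB
  let Z := (pencilPoly n A B).roots.toFinset
  have hZ : ∀ z, z ∈ Z ↔ (pencilPoly n A B).IsRoot z := fun z => by
    rw [Multiset.mem_toFinset, mem_roots hreg]
  let m : ℂ → ℕ := fun z => (minorOrder n (n - Fintype.card J) A B z).toNat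
  have hm : ∀ z, (m z : ℕ∞) = minorOrder n (n - Fintype.card J) A B z := fun z =>
    ENat.natCast_toNat (minorOrder_ne_top hreg (Nat.sub_le _ _))
  let q : ℂ[X] := ∏ z ∈ Z, (X - C z) ^ m z
  have hq : q.Monic := monic_prod_of_monic _ _ fun z _ => (monic_X_sub_C z).pow _
  have hqZ : ∀ z ∈ Z, m z ≤ q.rootMultiplicity z := fun z hz =>
    (le_rootMultiplicity_iff hq.ne_zero).mpr (Finset.dvd_prod_of_mem _ hz)
  have hqZ' : ∀ z ∉ Z, q.rootMultiplicity z = 0 := by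
    refine fun z hz => rootMultiplicity_eq_zero fun h0 => ?_
    rw [IsRoot, eval_prod, Finset.prod_eq_zero_iff] at h0
    obtain ⟨a, ha, ha'⟩ := h0
    rw [eval_pow, eval_sub, eval_X, eval_C] at ha'
    rw [sub_eq_zero.mp (eq_zero_of_pow_eq_zero ha')] at hz
    exact hz ha
  let F := (pencil (A.map MvPolynomial.C + FA) (B.map MvPolynomial.C + FB)).det
  have hF : ∀ y, F.map (MvPolynomial.eval y) = pencilPoly n (A + FA.map (MvPolynomial.eval y))
      (B + FB.map (MvPolynomial.eval y)) := fun y => map_eval_pencil_det A B FA FB id id y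
  obtain ⟨x, w, h1, h2⟩ := exists_sum_simple hB Z (fun z hz => (hZ z).mpr hz)
    (Finset.univ : Finset J)
  obtain ⟨y₀, hy₁, hy₂⟩ := h.exists_eq_sum x w
  obtain ⟨c, hc, hcP⟩ := exists_generic_rootMultiplicity_le (n := n) F hq (fun y => by
      rw [hF]
      refine Finset.prod_dvd_of_coprime (fun a _ b _ hab =>
        (pairwise_coprime_X_sub_C Function.injective_id hab).pow) fun z hz => ?_
      exact minorsDvd_card_iff.mp (le_minorOrder_iff.mp
        ((hm z).trans_le (h.minorOrder_sub_le y n z))))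
    (fun y => by
      rw [hF]
      exact natDegree_pencilPoly_le) (y₀ := y₀) (by
      rw [hF, coeff_pencilPoly, hy₂, add_zero]
      exact hB) (fun z => by
      rw [hF, hy₁, hy₂, add_zero]
      by_cases hz : z ∈ Z
      · have h3 := h1 z hz n le_rfl
        rw [minorOrder_card_of_regular (pencilRegular_of_det_ne_zero hB), Finset.card_univ,
          ← hm, Nat.cast_le] at h3
        exact (h3.trans (hqZ z hz)).trans (Nat.le_succ _)
      · exact (h2 z hz).trans (Nat.le_add_left _ _))
  refine ⟨c, hc, fun y hy z hz => ?_⟩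
  have := hcP y hy z
  rwa [hF, hqZ' z (fun h0 => hz ((hZ z).mp h0)), zero_add] at this

theorem exists_generic_simple (h : IsRankFamily J FA FB) (hreg : PencilRegular n A B) :
    ∃ c : MvPolynomial ι ℂ, c ≠ 0 ∧ ∀ y, MvPolynomial.eval y c ≠ 0 →
      ∀ z, (pencilPoly n A B).eval z ≠ 0 → (pencilPoly n (A + FA.map (MvPolynomial.eval y))
        (B + FB.map (MvPolynomial.eval y))).rootMultiplicity z ≤ 1 := by
  obtain ⟨a, ha⟩ := hreg.exists_eval_ne_zero
  obtain ⟨c, hc, hcP⟩ := exists_generic_and (h.exists_generic_eval_ne_zero ha)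
    ((h.moebius a).exists_generic_simple_of_det_ne_zero (A := B) (B := A + a • B)
      (by rwa [eval_pencilPoly] at ha))
  refine ⟨c, hc, fun y hy z hz => ?_⟩
  obtain ⟨h1, h2⟩ := hcP y hy
  by_contra! hcon
  obtain ⟨hza, h3⟩ := one_lt_rootMultiplicity_moebius h1 hcon
  have hsub : (z - a)⁻¹ ≠ 0 := inv_ne_zero (sub_ne_zero.mpr hza)
  have h4 := h2 (z - a)⁻¹ (by
    rw [eval_pencilPoly_moebius A B a hsub, inv_inv, add_sub_cancel]
    exact mul_ne_zero (pow_ne_zero n hsub) hz)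
  have h5 : A + a • B + (FA + (MvPolynomial.C a : MvPolynomial ι ℂ) • FB).map (MvPolynomial.eval y)
      = A + FA.map (MvPolynomial.eval y) + a • (B + FB.map (MvPolynomial.eval y)) := by
    ext i j
    simp
    ring
  rw [h5] at h4
  exact absurd h3 (not_lt.mpr h4)

end IsRankFamily

/-- The conjugate partition description of a finitely supported antitone sequence. -/
theorem le_iff_lt_countP {e : ℕ → ℕ} (he : Antitone e) {N : ℕ} (hN : ∀ j, N ≤ j → e j = 0)
    {t : ℕ} (ht : 0 < t) (j : ℕ) :
    t ≤ e j ↔ j < (((Multiset.range N).map e).filter (0 < ·)).countP (t ≤ ·) := by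
  have hcard : (((Multiset.range N).map e).filter (0 < ·)).countP (t ≤ ·)
      = ((Finset.range N).filter fun k => t ≤ e k).card := by
    rw [Multiset.countP_filter, Multiset.countP_map]
    simp only [Finset.card_def, Finset.filter_val, Finset.range_val]
    congr 1
    exact Multiset.filter_congr fun k _ => and_iff_left_of_imp fun h => ht.trans_le h
  rw [hcard]
  constructor
  · intro h
    rw [← Nat.succ_le_iff]
    calc j + 1 = (Finset.range (j + 1)).card := (Finset.card_range _).symm
      _ ≤ _ := Finset.card_le_card fun k hk => by
        have hk' := h.trans (he (Nat.lt_succ_iff.mp (Finset.mem_range.mp hk)))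
        rw [Finset.mem_filter, Finset.mem_range]
        refine ⟨?_, hk'⟩
        by_contra! hcon
        rw [hN k hcon] at hk'
        omega
  · intro h
    by_contra! hcon
    have hsub : ((Finset.range N).filter fun k => t ≤ e k) ⊆ Finset.range j := by
      intro k hk
      rw [Finset.mem_range]
      by_contra! hjk
      have := (Finset.mem_filter.mp hk).2.trans (he hjk)
      omega
    exact absurd (Finset.card_le_card hsub) (by rwa [Finset.card_range, not_le])

theorem filter_pos_map_range {e : ℕ → ℕ} {g N : ℕ} (hg : ∀ j, 0 < e j ↔ j < g) (hN : g ≤ N) :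
    ((Multiset.range N).map e).filter (0 < ·) = (Multiset.range g).map e := by
  rw [Multiset.filter_map]
  congr 1
  have : (Finset.range N).filter (fun j => 0 < e j) = Finset.range g := by
    ext j
    rw [Finset.mem_filter, Finset.mem_range, Finset.mem_range, hg]
    omega
  exact congrArg Finset.val this

/-- A finitely supported antitone sequence is determined by its multiset of positive values. -/
theorem Antitone.eq_of_filter_pos_eq {e f : ℕ → ℕ} (he : Antitone e) (hf : Antitone f) {N g : ℕ}
    (hN : ∀ j, N ≤ j → e j = 0) (hg : ∀ j, 0 < f j ↔ j < g)
    (h : ((Multiset.range N).map e).filter (0 < ·) = (Multiset.range g).map f) : e = f := by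
  rw [← filter_pos_map_range hg le_rfl] at h
  have key : ∀ t, 0 < t → ∀ j, t ≤ e j ↔ t ≤ f j := fun t ht j => by
    rw [le_iff_lt_countP he hN ht, h, ← le_iff_lt_countP hf (fun j hj => ?_) ht]
    have := (hg j).not.mpr (not_lt.mpr hj)
    omega
  ext1 j
  refine le_antisymm ?_ ?_
  · rcases Nat.eq_zero_or_pos (e j) with h0 | h0
    · omega
    · exact (key _ h0 j).mp le_rfl
  · rcases Nat.eq_zero_or_pos (f j) with h0 | h0
    · omega
    · exact (key _ h0 j).mpr le_rfl

theorem map_range_reflect {α : Type*} (f : ℕ → α) (n : ℕ) :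
    (Multiset.range n).map (fun j => f (n - 1 - j)) = (Multiset.range n).map f := by
  have h1 : (List.range n).map (fun j => f (n - 1 - j)) = ((List.range n).map f).reverse := by
    rw [← List.map_reverse, List.range_eq_range', List.reverse_range', List.map_map,
      ← List.range_eq_range', zero_add]
    rfl
  rw [Multiset.range, Multiset.map_coe, Multiset.map_coe, h1, Multiset.coe_eq_coe]
  exact List.reverse_perm _

section PartialMultiplicities

variable {n : ℕ} {A B A' B' : Matrix (Fin n) (Fin n) ℂ} {z : ℂ}

/-- Shifting the orders of the minors by `r` deletes the `r` largest partial multiplicities. -/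
theorem pmFin_eq_of_minorOrder_eq (hreg : PencilRegular n A B) {r : ℕ}
    (hm : ∀ k ≤ n, minorOrder n k A' B' z = minorOrder n (k - r) A B z)
    {g : ℕ} {nn : ℕ → ℕ} (hnn : Antitone nn) (hg : ∀ j, 0 < nn j ↔ j < g)
    (hpm : pmFin n A B z = (Multiset.range g).map nn) :
    pmFin n A' B' z = (Multiset.range (g - r)).map fun j => nn (r + j) := by
  let d : ℕ → ℕ := fun k => (minorOrder n (k + 1) A B z - minorOrder n k A B z).toNat
  let D : ℕ → ℕ := fun j => if j < n then d (n - 1 - j) else 0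
  have hd : ∀ k, k + 2 ≤ n → d k ≤ d (k + 1) := by
    intro k hk
    have h1 := minorOrder_convex hreg z hk
    simp only [d]
    rw [ENat.toNat_sub (minorOrder_ne_top hreg (by omega)),
      ENat.toNat_sub (minorOrder_ne_top hreg (by omega))]
    rw [show k + 1 + 1 = k + 2 from rfl]
    omega
  have hD : Antitone D := by
    refine antitone_nat_of_succ_le fun j => ?_
    by_cases hj : j + 1 < n
    · have h1 := hd (n - 1 - (j + 1)) (by omega)
      rw [show n - 1 - (j + 1) + 1 = n - 1 - j by omega] at h1
      simpa [D, hj, (Nat.lt_succ_self j).trans hj] using h1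
    · simp [D, hj]
  have hDn : ∀ j, n ≤ j → D j = 0 := fun j hj => if_neg (not_lt.mpr hj)
  have hDnn : D = nn := by
    refine hD.eq_of_filter_pos_eq hnn hDn hg ?_
    rw [← hpm, pmFin]
    conv_rhs => rw [← map_range_reflect]
    congr 1
    exact Multiset.map_congr rfl fun j hj => if_pos (Multiset.mem_range.mp hj)
  have hgn : g - r ≤ n := by
    by_contra! hcon
    have h1 := (hg n).mpr (by omega)
    rw [← hDnn, hDn n le_rfl] at h1
    exact lt_irrefl _ h1
  rw [← filter_pos_map_range (e := fun j => nn (r + j)) (N := n) (fun j => by rw [hg]; omega) hgn,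
    pmFin, ← map_range_reflect]
  congr 1
  refine Multiset.map_congr rfl fun j hj => ?_
  rw [Multiset.mem_range] at hj
  rw [hm _ (by omega), hm _ (by omega), ← hDnn]
  simp only [D, d]
  split_ifs with h
  · rw [show n - 1 - j + 1 - r = n - 1 - (r + j) + 1 by omega,
      show n - 1 - j - r = n - 1 - (r + j) by omega]
  · rw [show n - 1 - j + 1 - r = 0 by omega, show n - 1 - j - r = 0 by omega]
    simp [minorOrder_zero]

theorem PencilRegular.swap (h : PencilRegular n A B) : PencilRegular n B A := by
  obtain ⟨t, ht⟩ : ∃ t, (X * pencilPoly n A B).eval t ≠ 0 := by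
    by_contra! hcon
    exact mul_ne_zero X_ne_zero h (Polynomial.funext fun z => by rw [hcon, eval_zero])
  rw [eval_mul, eval_X] at ht
  have ht0 := left_ne_zero_of_mul ht
  have h1 := eval_pencilPoly_moebius A B 0 (inv_ne_zero ht0)
  rw [zero_smul, add_zero, zero_add, inv_inv] at h1
  exact pencilRegular_of_eval_ne_zero (z := t⁻¹)
    (h1 ▸ mul_ne_zero (pow_ne_zero n (inv_ne_zero ht0)) (right_ne_zero_of_mul ht))

theorem rootMultiplicity_eq_one_of_pmFin (hreg : PencilRegular n A B)
    (hreg' : PencilRegular n A' B')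
    (hsimple : ∀ z, (pencilPoly n A B).eval z ≠ 0 → (pencilPoly n A' B').rootMultiplicity z ≤ 1)
    (h' : pmFin n A' B' z ≠ 0) (h : ¬ pmFin n A B z ≠ 0) :
    (pencilPoly n A' B').rootMultiplicity z = 1 := by
  rw [Ne, pmFin_eq_zero_iff hreg', not_not] at h'
  rw [not_not, pmFin_eq_zero_iff hreg] at h
  exact le_antisymm (hsimple z h) ((rootMultiplicity_pos hreg').mpr h')

variable {ι J : Type*} [Fintype J] {FA FB : Matrix (Fin n) (Fin n) (MvPolynomial ι ℂ)}

theorem IsRankFamily.exists_generic_regular (hF : IsRankFamily J FA FB)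
    (hreg : PencilRegular n A B) :
    ∃ c : MvPolynomial ι ℂ, c ≠ 0 ∧ ∀ y, MvPolynomial.eval y c ≠ 0 →
      PencilRegular n (A + FA.map (MvPolynomial.eval y)) (B + FB.map (MvPolynomial.eval y)) := by
  obtain ⟨a, ha⟩ := hreg.exists_eval_ne_zero
  obtain ⟨c, hc, hcP⟩ := hF.exists_generic_eval_ne_zero ha
  exact ⟨c, hc, fun y hy => pencilRegular_of_eval_ne_zero (hcP y hy)⟩

theorem IsRankFamily.exists_generic_pmAt_eq (hF : IsRankFamily J FA FB)
    (hreg : PencilRegular n A B) {μ : Option ℂ} {g : ℕ} {nn : ℕ → ℕ} (hnn : Antitone nn)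
    (hg : ∀ j, 0 < nn j ↔ j < g) (hpm : pmAt n A B μ = (Multiset.range g).map nn) :
    ∃ c : MvPolynomial ι ℂ, c ≠ 0 ∧ ∀ y, MvPolynomial.eval y c ≠ 0 →
      pmAt n (A + FA.map (MvPolynomial.eval y)) (B + FB.map (MvPolynomial.eval y)) μ
        = (Multiset.range (g - Fintype.card J)).map fun j => nn (Fintype.card J + j) := by
  cases μ with
  | some z =>
    obtain ⟨c, hc, hcP⟩ := hF.exists_generic_minorOrder_eq (A := A) (B := B) z
    exact ⟨c, hc, fun y hy => pmFin_eq_of_minorOrder_eq hreg (hcP y hy) hnn hg hpm⟩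
  | none =>
    obtain ⟨c, hc, hcP⟩ := hF.swap.exists_generic_minorOrder_eq (A := B) (B := A) 0
    exact ⟨c, hc, fun y hy => pmFin_eq_of_minorOrder_eq hreg.swap (hcP y hy) hnn hg hpm⟩

theorem IsRankFamily.exists_generic_algMultAt_eq_one (hF : IsRankFamily J FA FB)
    (hreg : PencilRegular n A B) :
    ∃ c : MvPolynomial ι ℂ, c ≠ 0 ∧ ∀ y, MvPolynomial.eval y c ≠ 0 → ∀ μ,
      IsEigenvalue n (A + FA.map (MvPolynomial.eval y)) (B + FB.map (MvPolynomial.eval y)) μ →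
      ¬ IsEigenvalue n A B μ →
      algMultAt n (A + FA.map (MvPolynomial.eval y)) (B + FB.map (MvPolynomial.eval y)) μ = 1 := by
  obtain ⟨c, hc, hcP⟩ := exists_generic_and (hF.exists_generic_regular hreg)
    (exists_generic_and (hF.exists_generic_simple hreg) (hF.swap.exists_generic_simple hreg.swap))
  refine ⟨c, hc, fun y hy μ h' h => ?_⟩
  obtain ⟨h1, h2, h3⟩ := hcP y hy
  cases μ with
  | some z => exact rootMultiplicity_eq_one_of_pmFin hreg h1 h2 h' h
  | none => exact rootMultiplicity_eq_one_of_pmFin hreg.swap h1.swap h3 h' h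

end PartialMultiplicities

section HermitianFamily

variable {n l s : ℕ}

/-- The entry `cEnt` with complex parameters in place of the real and imaginary part. -/
noncomputable def entC (y : IdxR l s n → ℂ) (t : IdxC l s n) : ℂ :=
  y (.inr (.inl t)) + y (.inr (.inr t)) * Complex.I

/-- The conjugate of `cEnt` with complex parameters in place of the real and imaginary part. -/
noncomputable def entConjC (y : IdxR l s n → ℂ) (t : IdxC l s n) : ℂ :=
  y (.inr (.inl t)) - y (.inr (.inr t)) * Complex.I

/-- The common shape of the two coefficients of `Φ_s` over the polynomial ring in the parameters:
`a` selects the scalar parameters, and `b` selects the vectors paired with the `v_j`. -/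
noncomputable def phiPoly (n : ℕ) {l s : ℕ} (a : Fin l → Fin l ⊕ Fin l)
    (b : Fin s → Fin l ⊕ (Fin s ⊕ Fin s ⊕ Fin s)) :
    Matrix (Fin n) (Fin n) (MvPolynomial (IdxR l s n) ℂ) :=
  let Z : IdxC l s n → MvPolynomial (IdxR l s n) ℂ := fun t =>
    MvPolynomial.X (.inr (.inl t)) + MvPolynomial.X (.inr (.inr t)) * MvPolynomial.C Complex.I
  let W : IdxC l s n → MvPolynomial (IdxR l s n) ℂ := fun t =>
    MvPolynomial.X (.inr (.inl t)) - MvPolynomial.X (.inr (.inr t)) * MvPolynomial.C Complex.I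
  of fun k m => ∑ i, MvPolynomial.X (.inl (a i)) * (Z (.inl i, k) * W (.inl i, m))
    + ∑ j, (Z (.inr (.inl j), k) * W (b j, m) + Z (b j, k) * W (.inr (.inl j), m))

theorem map_eval_phiPoly (a : Fin l → Fin l ⊕ Fin l)
    (b : Fin s → Fin l ⊕ (Fin s ⊕ Fin s ⊕ Fin s)) (y : IdxR l s n → ℂ) :
    (phiPoly n a b).map (MvPolynomial.eval y) = of fun k m =>
      ∑ i, y (.inl (a i)) * (entC y (.inl i, k) * entConjC y (.inl i, m))
        + ∑ j, (entC y (.inr (.inl j), k) * entConjC y (b j, m)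
          + entC y (b j, k) * entConjC y (.inr (.inl j), m)) := by
  ext k m
  simp [phiPoly, entC, entConjC]

theorem entC_ofReal (y : IdxR l s n → ℝ) (t : IdxC l s n) :
    entC (fun i => (y i : ℂ)) t = cEnt y t := rfl

theorem entConjC_ofReal (y : IdxR l s n → ℝ) (t : IdxC l s n) :
    entConjC (fun i => (y i : ℂ)) t = star (cEnt y t) := by
  simp [entConjC, cEnt, sub_eq_add_neg]

theorem phiHermA_eq (y : IdxR l s n → ℝ) :
    PhiHermA n l s y = (phiPoly n Sum.inl fun j => .inr (.inr (.inl j))).map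
      (MvPolynomial.eval fun i => (y i : ℂ)) := by
  rw [map_eval_phiPoly]
  ext k m
  simp [entC_ofReal, entConjC_ofReal, PhiHermA, Matrix.sum_apply, vecMulVec_apply]

theorem phiHermB_eq (y : IdxR l s n → ℝ) :
    PhiHermB n l s y = (phiPoly n Sum.inr fun j => .inr (.inr (.inr j))).map
      (MvPolynomial.eval fun i => (y i : ℂ)) := by
  rw [map_eval_phiPoly]
  ext k m
  simp [entC_ofReal, entConjC_ofReal, PhiHermB, Matrix.sum_apply, vecMulVec_apply]

theorem isRankFamily_phiPoly :
    IsRankFamily (Fin l ⊕ Fin s ⊕ Fin s)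
      (phiPoly n (l := l) (s := s) Sum.inl fun j => .inr (.inr (.inl j)))
      (phiPoly n Sum.inr fun j => .inr (.inr (.inr j))) := by
  refine ⟨fun y p q => ?_, fun x w α β => ?_⟩
  · refine ⟨Sum.elim
        (fun i k => (p * C (y (.inl (.inl i))) + q * C (y (.inl (.inr i)))) * C (entC y (.inl i, k)))
        (Sum.elim (fun j k => C (entC y (.inr (.inl j), k)))
          (fun j k => p * C (entC y (.inr (.inr (.inl j)), k))
            + q * C (entC y (.inr (.inr (.inr j)), k)))),
      Sum.elim (fun i m => C (entConjC y (.inl i, m)))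
        (Sum.elim (fun j m => p * C (entConjC y (.inr (.inr (.inl j)), m))
            + q * C (entConjC y (.inr (.inr (.inr j)), m)))
          (fun j m => C (entConjC y (.inr (.inl j), m)))), ?_⟩
    rw [map_eval_phiPoly, map_eval_phiPoly]
    ext1 k m
    rw [Matrix.add_apply, Matrix.smul_apply, Matrix.smul_apply, Matrix.map_apply, Matrix.map_apply,
      of_apply, of_apply, Matrix.sum_apply, Fintype.sum_sum_type,
      Fintype.sum_sum_type, ← Finset.sum_add_distrib]
    simp only [vecMulVec_apply, Sum.elim_inl, Sum.elim_inr, smul_eq_mul, map_add, map_sum, map_mul]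
    rw [mul_add, mul_add, add_add_add_comm, Finset.mul_sum, Finset.mul_sum, Finset.mul_sum,
      Finset.mul_sum, ← Finset.sum_add_distrib, ← Finset.sum_add_distrib]
    refine congrArg₂ _ (Finset.sum_congr rfl fun i _ => ?_) (Finset.sum_congr rfl fun j _ => ?_)
    · ring
    · ring
  · let Z : IdxC l s n → ℂ := fun t => Sum.elim (fun i => x (.inl i) t.2)
      (Sum.elim (fun j => x (.inr (.inl j)) t.2)
        (Sum.elim (fun j => α * x (.inr (.inr j)) t.2) fun j => β * x (.inr (.inr j)) t.2)) t.1
    let W : IdxC l s n → ℂ := fun t => Sum.elim (fun i => w (.inl i) t.2)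
      (Sum.elim (fun j => w (.inr (.inr j)) t.2)
        (Sum.elim (fun j => α * w (.inr (.inl j)) t.2) fun j => β * w (.inr (.inl j)) t.2)) t.1
    let y : IdxR l s n → ℂ := Sum.elim (Sum.elim (fun _ => α) fun _ => β)
      (Sum.elim (fun t => (Z t + W t) / 2) fun t => -((Z t - W t) / 2) * Complex.I)
    have hZ : ∀ t, entC y t = Z t := by
      intro t
      simp only [entC, y, Sum.elim_inr, Sum.elim_inl]
      linear_combination -((Z t - W t) / 2) * Complex.I_mul_I
    have hW : ∀ t, entConjC y t = W t := by
      intro t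
      simp only [entConjC, y, Sum.elim_inr, Sum.elim_inl]
      linear_combination ((Z t - W t) / 2) * Complex.I_mul_I
    refine ⟨y, ?_, ?_⟩
    all_goals
      rw [map_eval_phiPoly]
      ext1 k m
      rw [of_apply, Matrix.smul_apply, Matrix.sum_apply, Fintype.sum_sum_type,
        Fintype.sum_sum_type, ← Finset.sum_add_distrib]
      simp only [hZ, hW, vecMulVec_apply, smul_eq_mul, mul_add, Finset.mul_sum]
      simp only [Z, W, y, Sum.elim_inl, Sum.elim_inr]
      refine congrArg₂ _ rfl (Finset.sum_congr rfl fun j _ => ?_)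
      ring

end HermitianFamily

/-- **Generic change under low-rank structure-preserving perturbations of Hermitian
pencils.** If `L(λ) = A + λB` is a regular Hermitian pencil with pairwise distinct
eigenvalues `Λ 1, …, Λ κ` (finite or infinite) with partial multiplicities
`nn i 0 ≥ … ≥ nn i (g i − 1) > 0`, then for `1 ≤ r` and `s ≤ ⌊r/2⌋`, with
`ℓ = r − 2s`, there is a generic set `G_s ⊆ ℝ^{2ℓ+2(r+s)n}` such that for all
parameter tuples in `G_s`, with `E = Φ_s` of the tuple: `L + E` is regular; the
partial multiplicities of `L + E` at `Λ i` are exactly `nn i r ≥ … ≥ nn i (g i − 1)`;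
and every eigenvalue of `L + E` that is not an eigenvalue of `L` is simple. -/
theorem generic_low_rank_perturbation_hermitian
    (n κ r s : ℕ) (hr : 1 ≤ r) (hs : s ≤ r / 2)
    (A B : Matrix (Fin n) (Fin n) ℂ)
    (hA : A.IsHermitian) (hB : B.IsHermitian)
    (hreg : PencilRegular n A B)
    (Λ : Fin κ → Option ℂ) (hΛ : Function.Injective Λ)
    (heig : ∀ μ : Option ℂ, IsEigenvalue n A B μ ↔ ∃ i, Λ i = μ)
    (g : Fin κ → ℕ) (nn : Fin κ → ℕ → ℕ)
    (hmono : ∀ i, ∀ j k : ℕ, j ≤ k → nn i k ≤ nn i j)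
    (hgpos : ∀ i, ∀ j : ℕ, 0 < nn i j ↔ j < g i)
    (hpm : ∀ i, pmAt n A B (Λ i) = (Multiset.range (g i)).map (nn i)) :
    ∃ G : Set (IdxR (r - 2 * s) s n → ℝ), IsGenericR (IdxR (r - 2 * s) s n) G ∧
      ∀ y ∈ G,
        PencilRegular n (A + PhiHermA n (r - 2 * s) s y) (B + PhiHermB n (r - 2 * s) s y) ∧
        (∀ i, pmAt n (A + PhiHermA n (r - 2 * s) s y) (B + PhiHermB n (r - 2 * s) s y) (Λ i)
            = (Multiset.range (g i - r)).map fun j => nn i (r + j)) ∧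
        (∀ μ : Option ℂ,
          IsEigenvalue n (A + PhiHermA n (r - 2 * s) s y) (B + PhiHermB n (r - 2 * s) s y) μ →
          ¬ IsEigenvalue n A B μ →
          algMultAt n (A + PhiHermA n (r - 2 * s) s y) (B + PhiHermB n (r - 2 * s) s y) μ = 1) := by
  have hF := isRankFamily_phiPoly (n := n) (l := r - 2 * s) (s := s)
  have hcard : Fintype.card (Fin (r - 2 * s) ⊕ Fin s ⊕ Fin s) = r := by
    simp only [Fintype.card_sum, Fintype.card_fin]
    omega
  obtain ⟨c, hc, hcP⟩ := exists_generic_and (hF.exists_generic_regular hreg)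
    (exists_generic_and
      (exists_generic_forall Finset.univ fun i _ =>
        hF.exists_generic_pmAt_eq hreg (fun _ _ h => hmono i _ _ h) (hgpos i) (hpm i))
      (hF.exists_generic_algMultAt_eq_one hreg))
  refine ⟨_, isGenericR_of_eval_ne_zero hc, fun y hy => ?_⟩
  rw [phiHermA_eq, phiHermB_eq]
  obtain ⟨h1, h2, h3⟩ := hcP _ hy
  refine ⟨h1, fun i => ?_, h3⟩
  rw [h2 i (Finset.mem_univ i), hcard]
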